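/- arXiv:1311.0113 — 4 statements merged into one kernel-verified Lean document; each statement's English description precedes it below -/
import Mathlib

section
/- Let F be a finite field with q = p^a elements (p prime) and suppose N ≤ G ≤ AΓL(1,q), where N is the group of translations. Let γ ⊆ F with |γ| = k and 1 ≤ k ≤ q−1, and suppose the setwise stabiliser G_γ is transitive on γ × (F ∖ γ). Then k ∈ {1, q−1} if and only if G_γ ∩ N = 1, i.e. G_γ contains no nontrivial translation. -/
variable {α : Type*} [DecidableEq α]

/-- The image of a finset under a permutation. -/
def pact (g : Equiv.Perm α) (s : Finset α) : Finset α := s.image g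

/-- Adjacency in the Johnson graph `J(v,k)`: two `k`-subsets meeting in `k-1` points. -/
def JAdj (k : ℕ) (s t : Finset α) : Prop := s ≠ t ∧ (s ∩ t).card = k - 1

/-- The neighbour set `Γ₁` of a code `Γ` of `k`-subsets: the `k`-subsets not in `Γ`
adjacent to at least one member of `Γ`. -/
def nbrSet (k : ℕ) (Γ : Set (Finset α)) : Set (Finset α) :=
  {β | β.card = k ∧ β ∉ Γ ∧ ∃ γ ∈ Γ, JAdj k γ β}

/-- `G` leaves `Γ` invariant. -/
def Invariant (G : Set (Equiv.Perm α)) (Γ : Set (Finset α)) : Prop :=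
  ∀ g ∈ G, ∀ γ ∈ Γ, pact g γ ∈ Γ

/-- `G` is transitive on the collection `Γ` of finsets. -/
def TransOn (G : Set (Equiv.Perm α)) (Γ : Set (Finset α)) : Prop :=
  ∀ γ ∈ Γ, ∀ γ' ∈ Γ, ∃ g ∈ G, pact g γ = γ'

/-- `G` is transitive on the points. -/
def TransOnPts (G : Set (Equiv.Perm α)) : Prop := ∀ x y : α, ∃ g ∈ G, g x = y

/-- `Γ` is `G`-neighbour-transitive: `G` is transitive on `Γ` and on its neighbour set. -/
def NbrTrans (G : Set (Equiv.Perm α)) (k : ℕ) (Γ : Set (Finset α)) : Prop :=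
  TransOn G Γ ∧ TransOn G (nbrSet k Γ)

/-- `Γ` is `G`-incidence-transitive: `G` is transitive on adjacent pairs
`(γ, γ₁) ∈ Γ × Γ₁`. -/
def IncTrans (G : Set (Equiv.Perm α)) (k : ℕ) (Γ : Set (Finset α)) : Prop :=
  ∀ γ ∈ Γ, ∀ γ₁ ∈ nbrSet k Γ, JAdj k γ γ₁ →
    ∀ γ' ∈ Γ, ∀ γ₁' ∈ nbrSet k Γ, JAdj k γ' γ₁' →
      ∃ g ∈ G, pact g γ = γ' ∧ pact g γ₁ = γ₁'

/-- `Γ` is `G`-strongly incidence-transitive: `G` is transitive on `Γ` and, for each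
`γ ∈ Γ`, the setwise stabiliser of `γ` is transitive on `γ × (𝒱 ∖ γ)`. -/
def StrIncTrans (G : Set (Equiv.Perm α)) (Γ : Set (Finset α)) : Prop :=
  TransOn G Γ ∧
  ∀ γ ∈ Γ, ∀ u ∈ γ, ∀ w ∉ γ, ∀ u' ∈ γ, ∀ w' ∉ γ,
    ∃ g ∈ G, pact g γ = γ ∧ g u = u' ∧ g w = w'

/-- The minimum (Johnson) distance of `Γ` is at least `d`. -/
def MinDistGE (d : ℕ) (Γ : Set (Finset α)) : Prop :=
  ∀ s ∈ Γ, ∀ t ∈ Γ, s ≠ t → d ≤ s.card - (s ∩ t).card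

/-- The minimum (Johnson) distance of a code `Γ`. -/
noncomputable def minDist (Γ : Set (Finset α)) : ℕ :=
  sInf {d | ∃ s ∈ Γ, ∃ t ∈ Γ, s ≠ t ∧ d = s.card - (s ∩ t).card}

theorem perm_inv_apply14 {F : Type*} (g : Equiv.Perm F) (x : F) : g⁻¹ (g x) = x := by
  simp

theorem pact_eq_iff {F : Type*} [DecidableEq F] (g : Equiv.Perm F) (γ : Finset F) :
    pact g γ = γ ↔ ∀ x, g x ∈ γ ↔ x ∈ γ := by
  unfold pact
  constructor
  · intro h x
    constructor
    · intro hx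
      rw [← h, Finset.mem_image] at hx
      obtain ⟨y, hy, hyx⟩ := hx
      rwa [← g.injective hyx]
    · intro hx
      rw [← h]
      exact Finset.mem_image_of_mem _ hx
  · intro h
    ext y
    rw [Finset.mem_image]
    constructor
    · rintro ⟨x, hx, rfl⟩
      exact (h x).2 hx
    · intro hy
      refine ⟨g.symm y, ?_, by simp⟩
      rw [← h]
      simpa using hy

/-- The setwise stabiliser as a subgroup. -/
def setStab14 {F : Type*} (G : Subgroup (Equiv.Perm F)) (γ : Finset F) :
    Subgroup (Equiv.Perm F) where
  carrier := {g | g ∈ G ∧ ∀ x, g x ∈ γ ↔ x ∈ γ}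
  mul_mem' := by
    rintro g h ⟨hg, hg'⟩ ⟨hh, hh'⟩
    exact ⟨G.mul_mem hg hh, fun x => by rw [Equiv.Perm.mul_apply, hg', hh']⟩
  one_mem' := ⟨G.one_mem, fun x => by simp⟩
  inv_mem' := by
    rintro g ⟨hg, hg'⟩
    refine ⟨G.inv_mem hg, fun x => ?_⟩
    rw [← hg' (g⁻¹ x)]
    simp

/-- A nontrivial affine element of `H` forces `H` to have a fixed point. -/
theorem fixed_of_affine {F : Type*} [Field F] (H : Subgroup (Equiv.Perm F))
    (hup : ∀ g ∈ H, ∃ (u w : F) (φ : F ≃+* F), u ≠ 0 ∧ ∀ x, g x = u * φ x + w)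
    (hT : ∀ g ∈ H, (∃ w : F, ∀ x, g x = x + w) → g = 1)
    (h : Equiv.Perm F) (hh : h ∈ H) (h1 : h ≠ 1) (u w : F)
    (hx : ∀ x, h x = u * x + w) : ∃ c : F, ∀ g ∈ H, g c = c := by
  have hu : u ≠ 1 := by
    rintro rfl
    exact h1 (hT h hh ⟨w, fun x => by rw [hx, one_mul]⟩)
  have hu' : 1 - u ≠ 0 := sub_ne_zero.2 hu.symm
  have huniq : ∀ x, h x = x → x = w / (1 - u) := by
    intro x h2
    rw [hx] at h2
    rw [eq_div_iff hu']
    linear_combination -h2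
  have hc : h (w / (1 - u)) = w / (1 - u) := by
    rw [hx]
    field_simp
    ring
  generalize w / (1 - u) = c at huniq hc
  have key : ∀ g ∈ H, g⁻¹ c = c := by
    intro g hg
    obtain ⟨v, t, φ, hv, hgx⟩ := hup g hg
    have hconj : ∀ y, (g * h * g⁻¹) y = φ u * y + (v * φ w + t - φ u * t) := by
      intro y
      obtain ⟨x, rfl⟩ := g.surjective y
      rw [Equiv.Perm.mul_apply, Equiv.Perm.mul_apply, perm_inv_apply14]
      simp only [hgx, hx, map_add, map_mul]
      ring
    have hkH : g * h * g⁻¹ ∈ H := H.mul_mem (H.mul_mem hg hh) (H.inv_mem hg)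
    generalize hk : g * h * g⁻¹ = k at hconj hkH
    generalize v * φ w + t - φ u * t = s at hconj
    have hcomm : (h * k) * (k * h)⁻¹ = 1 := by
      apply hT _ (H.mul_mem (H.mul_mem hh hkH) (H.inv_mem (H.mul_mem hkH hh)))
      refine ⟨u * s + w - (φ u * w + s), fun y => ?_⟩
      obtain ⟨x, rfl⟩ := (k * h).surjective y
      rw [Equiv.Perm.mul_apply, perm_inv_apply14]
      simp only [Equiv.Perm.mul_apply, hconj, hx]
      ring
    rw [mul_inv_eq_one] at hcomm
    have h3 : h (k c) = k c := by
      have := congrArg (fun f : Equiv.Perm F => f c) hcomm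
      simpa only [Equiv.Perm.mul_apply, hc] using this
    have h4 : ∀ x, h x = x → x = c := huniq
    have h5 : k c = c := h4 _ h3
    apply h4
    rw [← hk] at h5
    simp only [Equiv.Perm.mul_apply] at h5
    apply g.injective
    rw [h5]
    simp
  refine ⟨c, fun g hg => ?_⟩
  have := key g⁻¹ (H.inv_mem hg)
  rwa [inv_inv] at this

/-- If `H` contains no nontrivial affine maps, it has at most `q - 1` elements. -/
theorem card_le_of_no_affine {F : Type*} [Field F] [Fintype F] [DecidableEq F]
    (H : Subgroup (Equiv.Perm F))
    (hup : ∀ g ∈ H, ∃ (u w : F) (φ : F ≃+* F), u ≠ 0 ∧ ∀ x, g x = u * φ x + w)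
    (hA : ∀ h ∈ H, (∃ u w : F, ∀ x, h x = u * x + w) → h = 1) :
    Nat.card H ≤ Fintype.card F - 1 := by
  choose U W P hU hP using hup
  obtain ⟨ζ, hζ⟩ := IsCyclic.exists_generator (α := Fˣ)
  let f : H → Fˣ := fun g => Units.map (P g.1 g.2 : F →* F) ζ
  have hf : Function.Injective f := by
    intro g g' hgg
    have hφ : ∀ x, P g.1 g.2 x = P g'.1 g'.2 x := by
      intro x
      by_cases hx : x = 0
      · simp [hx]
      · obtain ⟨n, hn⟩ := Subgroup.mem_zpowers_iff.1 (hζ (Units.mk0 x hx))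
        have h2 : Units.map (P g.1 g.2 : F →* F) (Units.mk0 x hx)
            = Units.map (P g'.1 g'.2 : F →* F) (Units.mk0 x hx) := by
          rw [← hn, map_zpow, map_zpow]
          exact congrArg (· ^ n) hgg
        exact congrArg Units.val h2
    have h3 : g.1 * g'.1⁻¹ = 1 := by
      apply hA _ (H.mul_mem g.2 (H.inv_mem g'.2))
      refine ⟨U g.1 g.2 / U g'.1 g'.2,
        W g.1 g.2 - U g.1 g.2 / U g'.1 g'.2 * W g'.1 g'.2, fun y => ?_⟩
      obtain ⟨x, rfl⟩ := g'.1.surjective y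
      rw [Equiv.Perm.mul_apply, perm_inv_apply14, hP g.1 g.2, hP g'.1 g'.2, hφ]
      have := hU g'.1 g'.2
      field_simp
      ring
    exact Subtype.ext (mul_inv_eq_one.1 h3)
  have := Nat.card_le_card_of_injective f hf
  rwa [Nat.card_eq_fintype_card (α := Fˣ), Fintype.card_units] at this

/-- Lemma `k1`: `k ∈ {1, q-1}` iff `G_γ` contains no nontrivial
translation. -/
theorem stmt14 {F : Type*} [Field F] [Fintype F] [DecidableEq F] (p a q k : ℕ)
    (hp : p.Prime) (ha : 1 ≤ a) (hq : q = p ^ a) (hcard : Fintype.card F = q)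
    (G : Subgroup (Equiv.Perm F))
    (hGup : ∀ g ∈ G, ∃ (u w : F) (φ : F ≃+* F), u ≠ 0 ∧ ∀ x, g x = u * φ x + w)
    (hGlow : ∀ w : F, ∃ g ∈ G, ∀ x, g x = x + w)
    (γ : Finset F) (hγk : γ.card = k) (hk1 : 1 ≤ k) (hkq : k ≤ q - 1)
    (htrans : ∀ u ∈ γ, ∀ w ∉ γ, ∀ u' ∈ γ, ∀ w' ∉ γ,
        ∃ g ∈ G, pact g γ = γ ∧ g u = u' ∧ g w = w') :
    (k = 1 ∨ k = q - 1) ↔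
      (∀ g ∈ G, pact g γ = γ → (∃ w : F, ∀ x, g x = x + w) → g = 1) := by
  have hq0 : 0 < Fintype.card F := Fintype.card_pos
  have hq2 : 1 < Fintype.card F := Fintype.one_lt_card
  subst hcard
  have hcompl : γᶜ.card = Fintype.card F - k := by rw [Finset.card_compl, hγk]
  constructor
  · rintro hk g hg hγ ⟨w, hw⟩
    rw [pact_eq_iff] at hγ
    have hfix : ∃ c, g c = c := by
      rcases hk with hk | hk
      · rw [hk, Finset.card_eq_one] at hγk
        obtain ⟨c, rfl⟩ := hγk
        exact ⟨c, by simpa using hγ c⟩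
      · have : γᶜ.card = 1 := by omega
        rw [Finset.card_eq_one] at this
        obtain ⟨c, hc⟩ := this
        have hm : ∀ x, x ∉ γ ↔ x = c := by
          intro x
          rw [← Finset.mem_compl, hc, Finset.mem_singleton]
        exact ⟨c, by rw [← hm, hγ, hm]⟩
    obtain ⟨c, hc⟩ := hfix
    rw [hw] at hc
    have hw0 : w = 0 := by simpa using hc
    ext x
    simp [hw, hw0]
  · intro hT
    have hup : ∀ g ∈ setStab14 G γ,
        ∃ (u w : F) (φ : F ≃+* F), u ≠ 0 ∧ ∀ x, g x = u * φ x + w :=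
      fun g hg => hGup g hg.1
    have hT' : ∀ g ∈ setStab14 G γ, (∃ w : F, ∀ x, g x = x + w) → g = 1 :=
      fun g hg => hT g hg.1 ((pact_eq_iff g γ).2 hg.2)
    obtain ⟨u0, hu0⟩ : γ.Nonempty := Finset.card_pos.1 (by omega)
    obtain ⟨w0, hw0⟩ : γᶜ.Nonempty := Finset.card_pos.1 (by omega)
    rw [Finset.mem_compl] at hw0
    have htr : ∀ u ∈ γ, ∀ w ∉ γ, ∀ u' ∈ γ, ∀ w' ∉ γ,
        ∃ g ∈ setStab14 G γ, g u = u' ∧ g w = w' := by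
      intro u hu w hw u' hu' w' hw'
      obtain ⟨g, hg, h1, h2⟩ := htrans u hu w hw u' hu' w' hw'
      exact ⟨g, ⟨hg, (pact_eq_iff g γ).1 h1⟩, h2⟩
    by_cases hA : ∀ h ∈ setStab14 G γ, (∃ u w : F, ∀ x, h x = u * x + w) → h = 1
    · have hle := card_le_of_no_affine _ hup hA
      have hge : (γ ×ˢ γᶜ).card ≤ Nat.card (setStab14 G γ) := by
        have hsurj : ∀ z : (γ ×ˢ γᶜ : Finset (F × F)),
            ∃ g : setStab14 G γ, (g.1 u0, g.1 w0) = z.1 := by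
          rintro ⟨⟨u, w⟩, hz⟩
          rw [Finset.mem_product, Finset.mem_compl] at hz
          obtain ⟨g, hg, h1, h2⟩ := htr u0 hu0 w0 hw0 u hz.1 w hz.2
          exact ⟨⟨g, hg⟩, by rw [h1, h2]⟩
        choose e he using hsurj
        have hinj : Function.Injective e := by
          intro z z' hz
          apply Subtype.ext
          rw [← he, ← he, hz]
        have := Nat.card_le_card_of_injective e hinj
        simpa only [Nat.card_eq_fintype_card, Fintype.card_coe] using this
      rw [Finset.card_product, hcompl, hγk] at hge
      have hfin := hge.trans hle
      obtain ⟨m, hm⟩ : ∃ m, Fintype.card F = k + (m + 1) :=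
        ⟨Fintype.card F - k - 1, by omega⟩
      obtain ⟨n, rfl⟩ : ∃ n, k = n + 1 := ⟨k - 1, by omega⟩
      have e1 : Fintype.card F - (n + 1) = m + 1 := by omega
      have e2 : Fintype.card F - 1 = n + (m + 1) := by omega
      rw [e1, e2] at hfin
      have hnm : n * m = 0 := by nlinarith
      rcases Nat.mul_eq_zero.1 hnm with h | h
      · left; omega
      · right; omega
    · push Not at hA
      obtain ⟨h, hh, ⟨u, w, hx⟩, h1⟩ := hA
      obtain ⟨c, hc⟩ := fixed_of_affine _ hup hT' h hh h1 u w hx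
      by_cases hcγ : c ∈ γ
      · left
        rw [← hγk, Finset.card_eq_one]
        refine ⟨c, Finset.eq_singleton_iff_unique_mem.2 ⟨hcγ, fun x hxγ => ?_⟩⟩
        obtain ⟨g, hg, h2, -⟩ := htr c hcγ w0 hw0 x hxγ w0 hw0
        rw [← h2, hc g hg]
      · right
        have : γᶜ.card = 1 := by
          rw [Finset.card_eq_one]
          refine ⟨c, Finset.eq_singleton_iff_unique_mem.2
            ⟨Finset.mem_compl.2 hcγ, fun x hxγ => ?_⟩⟩
          obtain ⟨g, hg, -, h2⟩ := htr u0 hu0 c hcγ u0 hu0 x (Finset.mem_compl.1 hxγ)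
          rw [← h2, hc g hg]
        omega
end

section
/- Let F be a finite field with q = p^a elements (p prime) and suppose N ≤ G ≤ AΓL(1,q), where N is the group of translations. Let γ be a nonempty proper subset of F, let Y = { y ∈ F : the translation x ↦ x + y lies in G_γ }, and let K be the subfield of F generated by the set { u ∈ Fˣ : the scaling x ↦ u·x lies in G_γ }. If Y ≠ {0}, then Y is a K-linear subspace of F (Y is closed under addition and under multiplication by elements of K), and K is a proper subfield of F. -/
variable {α : Type*} [DecidableEq α]

/-- Lemma `kvecspace`: if the set `Y` of translations in `G_γ` is
nontrivial, then `Y` is a vector space over the subfield `K` generated by the scalings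
in `G_γ`, and `K` is a proper subfield of `F`. -/
theorem stmt15 {F : Type*} [Field F] [Fintype F] [DecidableEq F] (p a q : ℕ)
    (hp : p.Prime) (ha : 1 ≤ a) (hq : q = p ^ a) (hcard : Fintype.card F = q)
    (G : Subgroup (Equiv.Perm F))
    (hGup : ∀ g ∈ G, ∃ (u w : F) (φ : F ≃+* F), u ≠ 0 ∧ ∀ x, g x = u * φ x + w)
    (hGlow : ∀ w : F, ∃ g ∈ G, ∀ x, g x = x + w)
    (γ : Finset F) (hγne : γ.Nonempty) (hγproper : γ ≠ Finset.univ)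
    (Y : Set F) (hY : Y = {y | ∃ g ∈ G, pact g γ = γ ∧ ∀ x, g x = x + y})
    (K : Subfield F)
    (hK : K = Subfield.closure {u | u ≠ 0 ∧ ∃ g ∈ G, pact g γ = γ ∧ ∀ x, g x = u * x})
    (hYne : Y ≠ {0}) :
    (∀ y ∈ Y, ∀ z ∈ Y, y + z ∈ Y) ∧ (∀ c ∈ K, ∀ y ∈ Y, c * y ∈ Y) ∧ K ≠ ⊤ := by
  have hmem : ∀ y, y ∈ Y ↔ ∀ x ∈ γ, x + y ∈ γ := by
    intro y
    rw [hY]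
    constructor
    · rintro ⟨g, -, hg, hgx⟩ x hx
      rw [← hgx, ← hg]
      exact Finset.mem_image_of_mem g hx
    · intro h
      obtain ⟨g, hgG, hgx⟩ := hGlow y
      refine ⟨g, hgG, ?_, hgx⟩
      apply Finset.eq_of_subset_of_card_le
      · intro z hz
        obtain ⟨x, hx, rfl⟩ := Finset.mem_image.1 hz
        rw [hgx]
        exact h x hx
      · exact (Finset.card_image_of_injective γ g.injective).ge
  have hadd : ∀ y ∈ Y, ∀ z ∈ Y, y + z ∈ Y := by
    intro y hy z hz
    rw [hmem] at *
    intro x hx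
    rw [← add_assoc]
    exact hz _ (hy x hx)
  have hzero : (0 : F) ∈ Y := by
    rw [hmem]; simp
  have hneg : ∀ y ∈ Y, -y ∈ Y := by
    intro y hy
    have hy' := hy
    rw [hY] at hy'
    obtain ⟨g, -, hg, hgx⟩ := hy'
    rw [hmem]
    intro x hx
    rw [← hg] at hx
    obtain ⟨z, hz, rfl⟩ := Finset.mem_image.1 hx
    rw [hgx]
    simpa using hz
  have hsmul : ∀ c ∈ K, ∀ y ∈ Y, c * y ∈ Y := by
    intro c hc
    rw [hK] at hc
    induction hc using Subfield.closure_induction with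
    | mem u hu =>
      obtain ⟨hu0, g, -, hg, hgx⟩ := hu
      intro y hy
      rw [hmem] at *
      intro x hx
      rw [← hg] at hx
      obtain ⟨z, hz, rfl⟩ := Finset.mem_image.1 hx
      rw [hgx, ← mul_add, ← hgx, ← hg]
      exact Finset.mem_image_of_mem g (hy z hz)
    | one => intro y hy; simpa using hy
    | add c d _ _ ihc ihd =>
      intro y hy
      rw [add_mul]
      exact hadd _ (ihc y hy) _ (ihd y hy)
    | neg c _ ihc =>
      intro y hy
      rw [neg_mul]
      exact hneg _ (ihc y hy)
    | inv c _ ihc =>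
      have hpow : ∀ n : ℕ, ∀ y ∈ Y, c ^ n * y ∈ Y := by
        intro n
        induction n with
        | zero => intro y hy; simpa using hy
        | succ n ih =>
          intro y hy
          rw [pow_succ, mul_assoc]
          exact ih _ (ihc y hy)
      by_cases hc0 : c = 0
      · intro y _
        simpa [hc0] using hzero
      · have h1 := FiniteField.pow_card_sub_one_eq_one c hc0
        have h2 : 1 < Fintype.card F := Fintype.one_lt_card
        have h3 : c⁻¹ = c ^ (Fintype.card F - 2) := by
          apply inv_eq_of_mul_eq_one_right
          rw [← pow_succ', ← h1]
          congr 1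
          omega
        rw [h3]
        exact hpow _
    | mul c d _ _ ihc ihd =>
      intro y hy
      rw [mul_assoc]
      exact ihc _ (ihd y hy)
  refine ⟨hadd, hsmul, ?_⟩
  intro htop
  have hex : ∃ y ∈ Y, y ≠ 0 := by
    by_contra hcon
    push Not at hcon
    apply hYne
    ext y
    exact ⟨fun hy => hcon y hy, fun hy => by rw [Set.mem_singleton_iff.1 hy]; exact hzero⟩
  obtain ⟨y, hy, hy0⟩ := hex
  apply hγproper
  obtain ⟨x, hx⟩ := hγne
  ext z
  simp only [Finset.mem_univ, iff_true]
  have h := hsmul ((z - x) / y) (by rw [htop]; trivial) y hy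
  rw [div_mul_cancel₀ _ hy0, hmem] at h
  simpa using h x hx
end

section
/- Let q = p^a be a prime power, n ≥ 3, and let 𝒱 be the point set of PG(n−1,q), i.e. the set of 1-dimensional subspaces of F_q^n, with v = |𝒱| = (q^n − 1)/(q − 1). Suppose PSL(n,q) ≤ G ≤ PΓL(n,q), let Γ be a nonempty proper G-invariant set of k-element subsets of 𝒱 with 3 ≤ k ≤ v−3 which is G-strongly incidence-transitive, and let γ ∈ Γ. Then either γ or its complement is the point set of a projective subspace (the set of 1-spaces contained in some F_q-linear subspace of F_q^n), or, after replacing γ by its complement if necessary, there is an integer x such that every projective line meets γ in exactly 0, x or q+1 points, and one of the following holds: (a) x = 2 and (v−1)/q + 1 ≤ k ≤ 2(v−1)/q; (b) q is a square, say q = q₀², x = q₀+1, (v−1)/q₀ + 1 ≤ k ≤ (v−1)/q₀ + (v−1)/q, and for every line λ meeting both γ and its complement there is a basis e, f of the corresponding 2-dimensional subspace such that λ ∩ γ = { ⟨s·e + t·f⟩ : s, t ∈ K, (s,t) ≠ (0,0) }, where K is the subfield of F_q of order q₀ (i.e. λ ∩ γ is a Baer sub-line of λ). -/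
/-- The set of projective points lying in a linear subspace `S`. -/
def subPts {F : Type*} [Field F] {n : ℕ} (S : Submodule F (Fin n → F)) :
    Set (Projectivization F (Fin n → F)) :=
  {pt | ∃ (v : Fin n → F) (hv : v ≠ 0), v ∈ S ∧ pt = Projectivization.mk F v hv}

theorem autCard {F : Type*} [Field F] [Fintype F] (p a : ℕ) (hp : p.Prime)
    (h : Fintype.card F = p ^ a) : Nat.card (F ≃+* F) = a := by
  have := Fact.mk hp
  have : CharP F p := by
    obtain ⟨r, hr⟩ := CharP.exists F
    obtain ⟨m, hr', hm⟩ := FiniteField.card F r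
    have : r = p := by
      have h1 : r ∣ p ^ a := by rw [← h, hm]; exact dvd_pow_self _ m.ne_zero
      exact (Nat.prime_dvd_prime_iff_eq hr' hp).1 (hr'.dvd_of_dvd_pow h1)
    rwa [← this]
  let _ : Algebra (ZMod p) F := ZMod.algebra F p
  have e : (F ≃+* F) ≃ Gal(F/ZMod p) :=
    { toFun := fun φ => AlgEquiv.ofRingEquiv (f := φ) (fun x => by
        have : (φ : F →+* F).comp (algebraMap (ZMod p) F) = algebraMap (ZMod p) F :=
          Subsingleton.elim _ _
        exact congrArg (fun f => f x) this)
      invFun := fun φ => φ.toRingEquiv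
      left_inv := fun φ => by ext; rfl
      right_inv := fun φ => by ext; rfl }
  rw [Nat.card_congr e, IsGalois.card_aut_eq_finrank]
  have := Module.card_eq_pow_finrank (K := ZMod p) (V := F)
  rw [h, ZMod.card] at this
  exact (Nat.pow_right_injective hp.two_le this).symm

/-- semilinear permutations of a coordinate plane. -/
def gammaL (F : Type*) [Field F] : Subgroup (Equiv.Perm (Fin 2 → F)) where
  carrier := {g | ∃ φ : F ≃+* F, (∀ x y, g (x + y) = g x + g y) ∧
    ∀ (c : F) x, g (c • x) = φ c • g x}
  one_mem' := ⟨RingEquiv.refl F, fun _ _ => rfl, fun _ _ => rfl⟩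
  mul_mem' := by
    rintro g h ⟨φ, h1, h2⟩ ⟨ψ, h3, h4⟩
    exact ⟨ψ.trans φ, fun x y => by simp [h1, h3], fun c x => by simp [h2, h4]⟩
  inv_mem' := by
    rintro g ⟨φ, h1, h2⟩
    refine ⟨φ.symm, fun x y => ?_, fun c x => ?_⟩
    · apply g.injective; simp [h1]
    · apply g.injective; simp [h2]

theorem gammaL_card {F : Type*} [Field F] [Fintype F] (q a : ℕ)
    (hq : Fintype.card F = q) (haut : Nat.card (F ≃+* F) = a) :
    Nat.card (gammaL F) = (q ^ 2 - 1) * (q ^ 2 - q) * a := by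
  classical
  let V := Fin 2 → F
  let sg : (F ≃+* F) → Equiv.Perm V := fun φ => Equiv.piCongrRight (fun _ => φ.toEquiv)
  let m : (V ≃ₗ[F] V) × (F ≃+* F) → gammaL F := fun x =>
    ⟨(sg x.2).trans x.1.toEquiv, x.2, fun v w => by
      have : sg x.2 (v + w) = sg x.2 v + sg x.2 w := by
        funext i; exact map_add x.2 _ _
      simp [this], fun c v => by
      have : sg x.2 (c • v) = x.2 c • sg x.2 v := by
        funext i; exact map_mul x.2 _ _
      simp [this]⟩
  have mval : ∀ A φ v, (m (A, φ)).1 v = A (fun i => φ (v i)) := fun A φ v => rfl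
  have hm : Function.Bijective m := by
    constructor
    · rintro ⟨A, φ⟩ ⟨B, ψ⟩ h
      have h' : ∀ v : V, A (fun i => φ (v i)) = B (fun i => ψ (v i)) := fun v => by
        rw [← mval, ← mval, h]
      have hAB : A = B := by
        apply LinearEquiv.toLinearMap_injective
        apply LinearMap.pi_ext'
        intro i
        ext1
        have := h' (Pi.single i 1)
        have e1 : ∀ φ : F ≃+* F, (fun j => φ ((Pi.single i 1 : V) j)) = Pi.single i 1 := by
          intro φ; funext j; by_cases hj : j = i
          · subst hj; simp
          · simp [hj]
        rw [e1, e1] at this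
        simpa using this
      subst hAB
      refine Prod.ext rfl ?_
      ext c
      have := A.injective (h' (fun _ => c))
      exact congrFun this 0
    · rintro ⟨g, φ, h1, h2⟩
      let A : V →ₗ[F] V :=
        { toFun := fun v => g (fun i => φ.symm (v i))
          map_add' := fun v w => by
            rw [← h1]; congr 1; funext i; exact map_add φ.symm _ _
          map_smul' := fun c v => by
            simp only [RingHom.id_apply]
            have := h2 (φ.symm c) (fun i => φ.symm (v i))
            rw [φ.apply_symm_apply] at this
            rw [← this]; congr 1; funext i; exact map_mul φ.symm _ _ }
      have hA : Function.Injective A := by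
        intro v w h
        have := g.injective h
        funext i
        exact φ.symm.injective (congrFun this i)
      refine ⟨(LinearEquiv.ofInjectiveEndo A hA, φ), ?_⟩
      ext1; ext1 v
      rw [mval]
      change g _ = g v
      congr 1; funext i; simp
  rw [← Nat.card_congr (Equiv.ofBijective m hm), Nat.card_prod, haut]
  have e : (V ≃ₗ[F] V) ≃ GL (Fin 2) F :=
    ((Matrix.GeneralLinearGroup.toLin (n := Fin 2) (R := F)).toEquiv.trans
      (LinearMap.GeneralLinearGroup.generalLinearEquiv F V).toEquiv).symm
  rw [Nat.card_congr e, Matrix.card_GL_field, hq, Fin.prod_univ_two]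
  simp

open Pointwise in
theorem orbit_dvd {F : Type*} [Field F] [Fintype F] (q a : ℕ)
    (hq : Fintype.card F = q) (haut : Nat.card (F ≃+* F) = a)
    (D : Set (Fin 2 → F)) (hne : D.Nonempty)
    (h : ∀ d ∈ D, ∀ d' ∈ D, ∃ (φ : F ≃+* F) (g : (Fin 2 → F) → (Fin 2 → F)),
      (∀ x y, g (x + y) = g x + g y) ∧ (∀ (c : F) x, g (c • x) = φ c • g x) ∧
      Function.Injective g ∧ (∀ v ∈ D, g v ∈ D) ∧ g d = d') :
    D.ncard ∣ (q ^ 2 - 1) * (q ^ 2 - q) * a := by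
  classical
  rw [← gammaL_card q a hq haut]
  let S : Subgroup (Equiv.Perm (Fin 2 → F)) := gammaL F ⊓ MulAction.stabilizer _ D
  obtain ⟨d, hd⟩ := hne
  have ho : MulAction.orbit S d = D := by
    ext d'
    constructor
    · rintro ⟨⟨g, hg1, hg2⟩, rfl⟩
      replace hg2 : g • D = D := hg2
      change g d ∈ D
      rw [← hg2]
      exact ⟨d, hd, rfl⟩
    · intro hd'
      obtain ⟨φ, g, h1, h2, h3, h4, h5⟩ := h d hd d' hd'
      let g' : Equiv.Perm (Fin 2 → F) := Equiv.ofBijective g (Finite.injective_iff_bijective.1 h3)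
      refine ⟨⟨g', ⟨φ, h1, h2⟩, ?_⟩, h5⟩
      change g' • D = D
      apply Set.eq_of_subset_of_ncard_le
      · rintro _ ⟨v, hv, rfl⟩
        exact h4 v hv
      · change D.ncard ≤ (g' '' D).ncard
        rw [Set.ncard_image_of_injective _ g'.injective]
      · exact Set.toFinite _
  rw [← ho, ← MulAction.index_stabilizer]
  exact (Subgroup.index_dvd_card _).trans (Subgroup.card_dvd_of_le inf_le_left)

theorem two_pow_bound (a : ℕ) (ha : 8 ≤ a) : 3 * a ^ 2 ≤ 2 ^ a := by
  induction a, ha using Nat.le_induction with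
  | base => norm_num
  | succ n hn ih => rw [pow_succ 2 n]; nlinarith

theorem fin_check : ∀ a ∈ Finset.range 8, ∀ i ∈ Finset.range 8, 2 ≤ i → i < a →
    ¬ (2 ^ a + 1 - 2 ^ i ∣ a * (2 ^ i - 2)) := by decide

theorem arith5 (p a i : ℕ) (hp : p.Prime) (hi : 1 ≤ i) (hia : i < a)
    (h : (p ^ a + 1 - p ^ i) ∣ a * ((p ^ a) ^ 2 - 1) * p ^ a) : p ^ i = 2 := by
  obtain ⟨j, rfl⟩ : ∃ j, a = i + j := ⟨a - i, by omega⟩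
  have hj : 1 ≤ j := by omega
  by_contra hx2
  have hx : 2 ≤ p ^ i := hp.two_le.trans (Nat.le_self_pow (by omega) p)
  have hm : 2 ≤ p ^ j := hp.two_le.trans (Nat.le_self_pow (by omega) p)
  have hxp : p ∣ p ^ i := dvd_pow_self p (by omega)
  set a := i + j with hadef
  have hqe : p ^ a = p ^ i * p ^ j := pow_add _ _ _
  have hx3 : 3 ≤ p ^ i := by omega
  obtain ⟨y, hy⟩ : ∃ y, p ^ i = y + 3 := ⟨p ^ i - 3, by omega⟩
  obtain ⟨m, hmm⟩ : ∃ m, p ^ j = m + 2 := ⟨p ^ j - 2, by omega⟩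
  have hd : p ^ a + 1 - p ^ i = p ^ i * (m + 1) + 1 := by
    rw [hqe, hmm]
    have : p ^ i * (m + 2) = p ^ i * (m + 1) + p ^ i := by ring
    omega
  set d := p ^ i * (m + 1) + 1 with hddef
  have hcop : Nat.Coprime d p := by
    rw [hddef]
    obtain ⟨t, ht⟩ := hxp
    rw [ht, mul_assoc, Nat.coprime_comm, Nat.coprime_mul_left_add_right]
    exact Nat.coprime_one_right _
  rw [hd] at h
  have h1 : d ∣ a * ((p ^ a) ^ 2 - 1) := (Nat.Coprime.pow_right a hcop).dvd_of_dvd_mul_right h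
  have hq1 : 1 ≤ (p ^ a) ^ 2 := Nat.one_le_pow _ _ (pow_pos hp.pos _)
  have h2 : d ∣ a * (p ^ i * (y + 1)) := by
    zify [hq1] at h1 ⊢
    have e1 : (p : ℤ) ^ a = d + (y + 3) - 1 := by
      have : (p : ℤ) ^ a = (y + 3) * (m + 2) := by exact_mod_cast (hy ▸ hmm ▸ hqe)
      rw [this, hddef, hy]; push_cast; ring
    have e2 : (p : ℤ) ^ i = y + 3 := by exact_mod_cast hy
    rw [e1] at h1
    rw [e2]
    have : (a : ℤ) * ((y + 3) * (y + 1)) =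
      a * (((d + (y + 3) - 1) ^ 2 - 1)) - d * (a * (d + 2 * (y + 2))) := by ring
    rw [this]
    exact dvd_sub h1 (dvd_mul_right _ _)
  have h3 : d ∣ a * (y + 1) := by
    rw [mul_left_comm] at h2
    exact (Nat.Coprime.pow_right i hcop).dvd_of_dvd_mul_left h2
  have h4 : d ∣ a * (2 * m + 3) := by
    have : a * d = (a * (y + 1)) * (m + 1) + a * (2 * m + 3) := by
      rw [hddef, hy]; ring
    exact (Nat.dvd_add_right (h3.mul_right _)).1 (this ▸ Dvd.intro_left a rfl)
  have l1 := Nat.le_of_dvd (by positivity) h3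
  have l2 := Nat.le_of_dvd (by positivity) h4
  rw [hddef, hy] at l1 l2
  have l3 : m + 2 ≤ a := by nlinarith
  have l4 : y + 3 < 3 * a := by nlinarith
  have l5 : p ^ a < 3 * a ^ 2 := by rw [hqe, hy, hmm]; nlinarith
  have l6 : a ≤ 7 := by
    by_contra hc
    have := two_pow_bound a (by omega)
    have := Nat.pow_le_pow_left hp.two_le a
    omega
  have hp3 : p ≤ 3 := by
    by_contra hc
    have := Nat.pow_le_pow_left (show 4 ≤ p by omega) a
    have : 2 ≤ a := by omega
    interval_cases a <;> omega
  have hp2 := hp.two_le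
  have hy1 : y + 1 = p ^ i - 2 := by omega
  rw [← hd, hy1] at h3
  have ha2 : 2 ≤ a := by omega
  clear_value a
  interval_cases p
  · have hi2 : 2 ≤ i := by
      by_contra hc
      have : i = 1 := by omega
      subst this; simp at hx3
    exact fin_check a (Finset.mem_range.2 (by omega)) i (Finset.mem_range.2 (by omega)) hi2 hia h3
  · have : a = 2 := by interval_cases a <;> simp at l5; rfl
    subst this
    have : i = 1 := by omega
    subst this
    revert h3; decide

theorem arith7 (a : ℕ) (ha : 3 ≤ a)
    (h : (2 ^ (a - 1) + 1) ∣ a * ((2 ^ a) ^ 2 - 1) * 2 ^ a) : False := by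
  obtain ⟨b, rfl⟩ : ∃ b, a = b + 1 := ⟨a - 1, by omega⟩
  simp only [Nat.add_sub_cancel] at h
  set t := 2 ^ b with ht
  have hcop : Nat.Coprime (t + 1) (2 ^ (b + 1)) := by
    apply Nat.Coprime.pow_right
    rw [ht, show b = (b - 1) + 1 by omega, pow_succ, mul_comm, Nat.coprime_comm,
      Nat.coprime_mul_left_add_right]
    exact Nat.coprime_one_right _
  have h1 := hcop.dvd_of_dvd_mul_right h
  have hq : 2 ^ (b + 1) = 2 * t := by rw [pow_succ, mul_comm]
  rw [hq] at h1
  have ht0 : 1 ≤ t := Nat.one_le_two_pow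
  have h2 : t + 1 ∣ (b + 1) * 3 := by
    have hh : 1 ≤ (2 * t) ^ 2 := Nat.one_le_pow _ _ (by omega)
    zify [hh] at h1 ⊢
    have : ((b : ℤ) + 1) * 3 = (b + 1) * ((2 * t) ^ 2 - 1) - (t + 1) * ((b + 1) * (4 * t - 4)) := by
      ring
    rw [this]
    exact dvd_sub h1 (dvd_mul_right _ _)
  have hb : b ≤ 6 := by
    by_contra hc
    have := Nat.le_of_dvd (by positivity) h2
    have h3 : 8 ≤ b + 1 := by omega
    have := two_pow_bound _ h3
    rw [hq] at this
    nlinarith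
  have : 2 ≤ b := by omega
  clear_value t
  interval_cases b <;> simp at ht <;> subst ht <;> revert h2 <;> decide

open Submodule in
/-- fibre counting for the map `v ↦ M ⊔ ⟨v⟩`. -/
theorem part_count {F V : Type*} [Field F] [AddCommGroup V] [Module F V] [Finite V]
    (M : Submodule F V) (s : Set V) (hs : ∀ v ∈ s, v ∉ M) (c : ℕ)
    (h : ∀ v ∈ s, (s ∩ ((M ⊔ span F {v} : Submodule F V) : Set V)).ncard = c) :
    s.ncard = c * ((fun v => M ⊔ span F {v}) '' s).ncard := by
  classical
  have hfib : ∀ v ∉ M, ∀ w ∉ M, (w ∈ M ⊔ span F {v} ↔ M ⊔ span F {w} = M ⊔ span F {v}) := by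
    intro v hv w hw
    constructor
    · intro hwv
      have h1 := covBy_span_singleton_sup (K := F) hv
      have h2 := covBy_span_singleton_sup (K := F) hw
      rw [sup_comm] at h1 h2
      have hle : M ⊔ span F {w} ≤ M ⊔ span F {v} :=
        sup_le le_sup_left ((span_singleton_le_iff_mem _ _).2 hwv)
      rcases h1.eq_or_eq le_sup_left hle with h3 | h3
      · exact absurd h3 h2.lt.ne'
      · exact h3
    · intro e
      rw [← e]
      exact mem_sup_right (mem_span_singleton_self w)
  have hfin : s.Finite := Set.toFinite s
  rw [Set.ncard_eq_toFinset_card s hfin,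
    Finset.card_eq_sum_card_image (fun v => M ⊔ span F {v}) hfin.toFinset]
  rw [Finset.sum_const_nat (m := c)]
  · rw [mul_comm]
    congr 1
    rw [← Set.ncard_coe_finset]
    congr 1
    simp
  · intro P hP
    obtain ⟨v, hv, rfl⟩ := Finset.mem_image.1 hP
    have hv' : v ∈ s := by simpa using hv
    rw [← h v hv', ← Set.ncard_coe_finset]
    congr 1
    ext w
    simp only [Finset.coe_filter, Set.Finite.mem_toFinset, Set.mem_ofPred_eq, Set.mem_inter_iff,
      SetLike.mem_coe]
    constructor
    · rintro ⟨hw, e⟩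
      exact ⟨hw, (hfib v (hs v hv') w (hs w hw)).2 e⟩
    · rintro ⟨hw, e⟩
      exact ⟨hw, (hfib v (hs v hv') w (hs w hw)).1 e⟩

open Submodule in
theorem finrank_add_one {F V : Type*} [Field F] [AddCommGroup V] [Module F V]
    [FiniteDimensional F V] (M : Submodule F V) {v : V} (hv : v ∉ M) :
    Module.finrank F (M ⊔ span F {v} : Submodule F V) = Module.finrank F M + 1 := by
  have h := finrank_sup_add_finrank_inf_eq M (span F {v})
  have hv0 : v ≠ 0 := fun h => hv (h ▸ M.zero_mem)
  have h2 : M ⊓ span F {v} = ⊥ := by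
    rw [eq_bot_iff]
    rintro w ⟨h1, h2⟩
    obtain ⟨c, rfl⟩ := mem_span_singleton.1 h2
    by_cases hc : c = 0
    · simp [hc]
    · exact absurd ((smul_mem_iff _ hc).1 h1) hv
  rw [h2, finrank_bot, finrank_span_singleton hv0] at h
  simpa using h

theorem sub_card {F V : Type*} [Field F] [AddCommGroup V] [Module F V] [Finite V]
    [FiniteDimensional F V] {q : ℕ} (hq : Nat.card F = q) (U : Submodule F V) :
    (U : Set V).ncard = q ^ Module.finrank F U := by
  rw [← hq, ← Module.natCard_eq_pow_finrank (K := F) (V := U)]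
  rfl

theorem span_inter_card {F V : Type*} [Field F] [AddCommGroup V] [Module F V] [Finite V]
    [FiniteDimensional F V] {q : ℕ} (hq : Nat.card F = q) (C : Set V) (h0 : (0 : V) ∉ C)
    (hsm : ∀ c : F, c ≠ 0 → ∀ v ∈ C, c • v ∈ C) {u : V} (hu : u ∈ C) :
    (C ∩ (Submodule.span F {u} : Submodule F V)).ncard = q - 1 := by
  have hu0 : u ≠ 0 := fun h => h0 (h ▸ hu)
  have e : C ∩ (Submodule.span F {u} : Submodule F V) =
      ((Submodule.span F {u} : Submodule F V) : Set V) \ {0} := by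
    ext w
    constructor
    · rintro ⟨h1, h2⟩
      exact ⟨h2, fun h => h0 (h ▸ h1)⟩
    · rintro ⟨h1, h2⟩
      obtain ⟨c, rfl⟩ := Submodule.mem_span_singleton.1 h1
      exact ⟨hsm c (fun h => h2 (by simp [h])) u hu, h1⟩
  rw [e, Set.ncard_sdiff_singleton_of_mem (Submodule.zero_mem _), sub_card hq,
    finrank_span_singleton hu0, pow_one]

open Submodule in
/-- all of `U` counted by planes... spaces through `M`. -/
theorem count_all {F V : Type*} [Field F] [AddCommGroup V] [Module F V] [Finite V]
    [FiniteDimensional F V] {q : ℕ} (hq : Nat.card F = q) (M U : Submodule F V) (hMU : M ≤ U) :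
    q ^ Module.finrank F U = q ^ Module.finrank F M +
      (q ^ (Module.finrank F M + 1) - q ^ Module.finrank F M) *
      ((fun v => M ⊔ span F {v}) '' ((U : Set V) \ M)).ncard := by
  rw [← part_count M _ (fun v hv => hv.2) _ ?_]
  · have := Set.ncard_sdiff_add_ncard_of_subset (s := (M : Set V)) (t := U) hMU
    rw [sub_card hq, sub_card hq] at this
    omega
  · rintro v ⟨hv, hvM⟩
    have e : ((U : Set V) \ M) ∩ ((M ⊔ span F {v} : Submodule F V) : Set V) =
        ((M ⊔ span F {v} : Submodule F V) : Set V) \ M := by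
      ext w
      constructor
      · rintro ⟨⟨h1, h2⟩, h3⟩; exact ⟨h3, h2⟩
      · rintro ⟨h3, h2⟩
        exact ⟨⟨sup_le hMU ((span_singleton_le_iff_mem _ _).2 hv) h3, h2⟩, h3⟩
    rw [e, Set.ncard_sdiff (show (M : Set V) ⊆ ((M ⊔ span F {v} : Submodule F V) : Set V) from
      SetLike.coe_subset_coe.2 le_sup_left), sub_card hq, sub_card hq,
      finrank_add_one M hvM]

open Submodule in
/-- `C ∩ U` counted by subspaces covering `M`, where each such subspace meets `C \ M` in `c`. -/
theorem count_part {F V : Type*} [Field F] [AddCommGroup V] [Module F V] [Finite V]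
    (C : Set V) (M U : Submodule F V) (hMU : M ≤ U) (c : ℕ)
    (h : ∀ v ∈ C, v ∈ U → v ∉ M → (C ∩ ((M ⊔ span F {v} : Submodule F V) : Set V)).ncard =
      (C ∩ M).ncard + c) :
    (C ∩ U).ncard = (C ∩ M).ncard + c *
      ((fun v => M ⊔ span F {v}) '' ((C ∩ U) \ M)).ncard := by
  rw [← part_count M _ (fun v hv => hv.2) _ ?_]
  · have e : (C ∩ U : Set V) = (C ∩ M) ∪ ((C ∩ U) \ M) := by
      ext w
      constructor
      · rintro ⟨h1, h2⟩
        by_cases h : w ∈ M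
        · exact Or.inl ⟨h1, h⟩
        · exact Or.inr ⟨⟨h1, h2⟩, h⟩
      · rintro (⟨h1, h2⟩ | ⟨h1, h2⟩)
        · exact ⟨h1, hMU h2⟩
        · exact h1
    conv_lhs => rw [e]
    refine Set.ncard_union_eq ?_ (Set.toFinite _) (Set.toFinite _)
    rw [Set.disjoint_left]
    rintro w ⟨_, h1⟩ ⟨_, h2⟩
    exact h2 h1
  · rintro v ⟨⟨hvC, hv⟩, hvM⟩
    have e : ((C ∩ U) \ M) ∩ ((M ⊔ span F {v} : Submodule F V) : Set V) =
        (C ∩ ((M ⊔ span F {v} : Submodule F V) : Set V)) \ (C ∩ M) := by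
      ext w
      constructor
      · rintro ⟨⟨h1, h2⟩, h3⟩; exact ⟨⟨h1.1, h3⟩, fun h => h2 h.2⟩
      · rintro ⟨⟨h1, h3⟩, h2⟩
        exact ⟨⟨⟨h1, sup_le hMU ((span_singleton_le_iff_mem _ _).2 hv) h3⟩,
          fun h => h2 ⟨h1, h⟩⟩, h3⟩
    rw [e, Set.ncard_sdiff, h v hvC hv hvM]
    · omega
    · exact Set.inter_subset_inter_right _ (SetLike.coe_subset_coe.2 le_sup_left)

open Submodule in
/-- If each covering subspace of `M` in `U` meets `C \ M`, images agree. -/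
theorem image_eq {F V : Type*} [Field F] [AddCommGroup V] [Module F V]
    (C : Set V) (M U : Submodule F V) (hMU : M ≤ U)
    (h : ∀ v ∈ U, v ∉ M → ∃ w ∈ C, w ∈ M ⊔ span F {v} ∧ w ∉ M) :
    ((fun v => M ⊔ span F {v}) '' ((C ∩ U) \ M)) =
      ((fun v => M ⊔ span F {v}) '' ((U : Set V) \ M)) := by
  ext P
  constructor
  · rintro ⟨v, ⟨h1, h2⟩, rfl⟩
    exact ⟨v, ⟨h1.2, h2⟩, rfl⟩
  · rintro ⟨v, ⟨h1, h2⟩, rfl⟩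
    obtain ⟨w, h3, h4, h5⟩ := h v h1 h2
    have hle : M ⊔ span F {w} ≤ M ⊔ span F {v} :=
        sup_le le_sup_left ((span_singleton_le_iff_mem _ _).2 h4)
    refine ⟨w, ⟨⟨h3, sup_le hMU ((span_singleton_le_iff_mem _ _).2 h1) h4⟩, h5⟩, ?_⟩
    have k1 := covBy_span_singleton_sup (K := F) h2
    have k2 := covBy_span_singleton_sup (K := F) h5
    rw [sup_comm] at k1 k2
    rcases k1.eq_or_eq le_sup_left hle with h6 | h6
    · exact absurd h6 k2.lt.ne'
    · exact h6

/-- cones: scaling invariant sets of nonzero vectors. -/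
structure IsCone (F : Type*) {V : Type*} [Field F] [AddCommGroup V] [Module F V]
    (C : Set V) : Prop where
  zero : (0 : V) ∉ C
  smul : ∀ c : F, c ≠ 0 → ∀ v ∈ C, c • v ∈ C

open Submodule in
/-- counting from a point of `C`. -/
theorem count_in {F V : Type*} [Field F] [AddCommGroup V] [Module F V] [Finite V]
    [FiniteDimensional F V] {q x : ℕ} (hq : Nat.card F = q) (hq2 : 2 ≤ q) (hx : 2 ≤ x)
    (C : Set V) (hC : IsCone F C) (U : Submodule F V) {u : V} (huC : u ∈ C) (huU : u ∈ U)
    (h : ∀ W : Submodule F V, Module.finrank F W = 2 → W ≤ U → u ∈ W →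
      (C ∩ W).ncard = (q - 1) * x) :
    ∃ N, q ^ Module.finrank F U = q + (q ^ 2 - q) * N ∧
      (C ∩ U).ncard = (q - 1) + (q - 1) * (x - 1) * N := by
  have hu0 : u ≠ 0 := fun h => hC.zero (h ▸ huC)
  have h1 := count_all hq (span F {u}) U ((span_singleton_le_iff_mem _ _).2 huU)
  have hs := span_inter_card hq C hC.zero hC.smul huC
  rw [finrank_span_singleton hu0, pow_one] at h1
  have hW : ∀ v ∈ U, v ∉ span F {u} →
      (C ∩ ((span F {u} ⊔ span F {v} : Submodule F V) : Set V)).ncard = (q - 1) * x := by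
    intro v hv hvu
    apply h
    · rw [finrank_add_one _ hvu, finrank_span_singleton hu0]
    · exact sup_le ((span_singleton_le_iff_mem _ _).2 huU) ((span_singleton_le_iff_mem _ _).2 hv)
    · exact mem_sup_left (mem_span_singleton_self u)
  have hxx : (q - 1) * x = (q - 1) + (q - 1) * (x - 1) := by
    obtain ⟨y, rfl⟩ : ∃ y, x = y + 1 := ⟨x - 1, by omega⟩
    simp; ring
  have h2 := count_part C (span F {u}) U ((span_singleton_le_iff_mem _ _).2 huU)
    ((q - 1) * (x - 1)) (fun v _ hv hvu => by rw [hW v hv hvu, hs, hxx])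
  rw [hs, image_eq] at h2
  · exact ⟨_, h1, h2⟩
  · exact ((span_singleton_le_iff_mem _ _).2 huU)
  · intro v hv hvu
    by_contra hc
    push Not at hc
    have : C ∩ ((span F {u} ⊔ span F {v} : Submodule F V) : Set V) ⊆ C ∩ (span F {u}) :=
      fun w hw => ⟨hw.1, hc w hw.1 hw.2⟩
    have := Set.ncard_le_ncard this
    rw [hs, hW v hv hvu] at this
    have : 1 * 1 ≤ (q - 1) * (x - 1) := Nat.mul_le_mul (by omega) (by omega)
    omega

open Submodule in
/-- counting from a point outside `C`. -/
theorem count_out {F V : Type*} [Field F] [AddCommGroup V] [Module F V] [Finite V]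
    [FiniteDimensional F V] {c : ℕ}
    (C : Set V) (hC : IsCone F C) (U : Submodule F V) {w : V} (hw0 : w ≠ 0) (hwC : w ∉ C)
    (hwU : w ∈ U)
    (h : ∀ W : Submodule F V, Module.finrank F W = 2 → W ≤ U → w ∈ W →
      (C ∩ W).Nonempty → (C ∩ W).ncard = c) :
    (C ∩ U).ncard = c *
      ((fun v => span F {w} ⊔ span F {v}) '' ((C ∩ U) \ (span F {w} : Submodule F V))).ncard := by
  have he : (C ∩ (span F {w} : Submodule F V) : Set V) = ∅ := by
    ext z
    simp only [Set.mem_inter_iff, SetLike.mem_coe, Set.mem_empty_iff_false, iff_false, not_and]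
    rintro hz hz2
    obtain ⟨a, rfl⟩ := mem_span_singleton.1 hz2
    have ha : a ≠ 0 := fun h => hC.zero (by simpa [h] using hz)
    apply hwC
    have := hC.smul a⁻¹ (inv_ne_zero ha) _ hz
    rwa [smul_smul, inv_mul_cancel₀ ha, one_smul] at this
  have hle := (span_singleton_le_iff_mem w U).2 hwU
  have := count_part C (span F {w}) U hle c (fun v hvC hv hvu => by
    rw [he, Set.ncard_empty, zero_add]
    apply h
    · rw [finrank_add_one _ hvu, finrank_span_singleton hw0]
    · exact sup_le hle ((span_singleton_le_iff_mem _ _).2 hv)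
    · exact mem_sup_left (mem_span_singleton_self w)
    · exact ⟨v, hvC, mem_sup_right (mem_span_singleton_self v)⟩)
  rwa [he, Set.ncard_empty, zero_add] at this

/-- the complementary cone. -/
def coCone {V : Type*} [AddCommGroup V] (C : Set V) : Set V := {v | v ≠ 0 ∧ v ∉ C}

theorem IsCone.co {F V : Type*} [Field F] [AddCommGroup V] [Module F V] {C : Set V}
    (hC : IsCone F C) : IsCone F (coCone C) where
  zero := fun h => h.1 rfl
  smul := by
    rintro c hc v ⟨h1, h2⟩
    refine ⟨smul_ne_zero hc h1, fun h => h2 ?_⟩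
    have := hC.smul c⁻¹ (inv_ne_zero hc) _ h
    rwa [smul_smul, inv_mul_cancel₀ hc, one_smul] at this

theorem IsCone.co_co {F V : Type*} [Field F] [AddCommGroup V] [Module F V] {C : Set V}
    (hC : IsCone F C) : coCone (coCone C) = C := by
  ext v
  constructor
  · rintro ⟨h1, h2⟩
    by_contra h
    exact h2 ⟨h1, h⟩
  · intro h
    exact ⟨fun h0 => hC.zero (h0 ▸ h), fun h2 => h2.2 h⟩

theorem IsCone.ne {F V : Type*} [Field F] [AddCommGroup V] [Module F V] {C : Set V}
    (hC : IsCone F C) {v : V} (h : v ∈ C) : v ≠ 0 := fun h0 => hC.zero (h0 ▸ h)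

theorem IsCone.not_mem_span {F V : Type*} [Field F] [AddCommGroup V] [Module F V] {C : Set V}
    (hC : IsCone F C) {u w : V} (hu : u ∈ C) (hw : w ∈ coCone C) :
    w ∉ Submodule.span F {u} := by
  intro h
  obtain ⟨c, rfl⟩ := Submodule.mem_span_singleton.1 h
  apply hw.2
  apply hC.smul c _ _ hu
  rintro rfl
  exact hw.1 (zero_smul _ _)

/-- strong incidence-transitivity on the level of vectors. -/
structure Good (F : Type*) {V : Type*} [Field F] [AddCommGroup V] [Module F V]
    (C : Set V) : Prop extends IsCone F C where
  trans : ∀ u ∈ C, ∀ w ∈ coCone C, ∀ u' ∈ C, ∀ w' ∈ coCone C,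
    ∃ (φ : F ≃+* F) (g : V → V), (∀ x y, g (x + y) = g x + g y) ∧
      (∀ (c : F) x, g (c • x) = φ c • g x) ∧ Function.Injective g ∧
      (∀ v, g v ∈ C ↔ v ∈ C) ∧ (∃ c : F, c ≠ 0 ∧ g u = c • u') ∧ (∃ c : F, c ≠ 0 ∧ g w = c • w')

theorem map_zero_of_add {V V' : Type*} [AddCommGroup V] [AddCommGroup V'] (g : V → V')
    (h : ∀ x y, g (x + y) = g x + g y) : g 0 = 0 := by
  have := h 0 0
  simpa using this

theorem Good.co {F V : Type*} [Field F] [AddCommGroup V] [Module F V] {C : Set V}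
    (hC : Good F C) : Good F (coCone C) where
  toIsCone := hC.toIsCone.co
  trans := by
    intro u hu w hw u' hu' w' hw'
    rw [hC.toIsCone.co_co] at hw hw'
    obtain ⟨φ, g, h1, h2, h3, h4, h5, h6⟩ := hC.trans w hw u hu w' hw' u' hu'
    refine ⟨φ, g, h1, h2, h3, fun v => ?_, h6, h5⟩
    have h0 := map_zero_of_add g h1
    have : g v = 0 ↔ v = 0 := ⟨fun h => h3 (h.trans h0.symm), fun h => h ▸ h0⟩
    change (g v ≠ 0 ∧ g v ∉ C) ↔ (v ≠ 0 ∧ v ∉ C)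
    rw [h4, Ne, this]

/-- transitivity with the second vector mapped exactly. -/
theorem Good.trans' {F V : Type*} [Field F] [AddCommGroup V] [Module F V] {C : Set V}
    (hC : Good F C) : ∀ u ∈ C, ∀ w ∈ coCone C, ∀ u' ∈ C, ∀ w' ∈ coCone C,
    ∃ (φ : F ≃+* F) (g : V → V), (∀ x y, g (x + y) = g x + g y) ∧
      (∀ (c : F) x, g (c • x) = φ c • g x) ∧ Function.Injective g ∧
      (∀ v, g v ∈ C ↔ v ∈ C) ∧ (∃ c : F, c ≠ 0 ∧ g u = c • u') ∧ g w = w' := by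
  intro u hu w hw u' hu' w' hw'
  obtain ⟨φ, g, h1, h2, h3, h4, ⟨c, hc, h5⟩, ⟨d, hd, h6⟩⟩ := hC.trans u hu w hw u' hu' w' hw'
  refine ⟨φ, fun v => d⁻¹ • g v, ?_, ?_, ?_, ?_, ⟨d⁻¹ * c, ?_, ?_⟩, ?_⟩
  · intro x y; simp [h1]
  · intro a x; simp only [h2]; rw [smul_comm]
  · intro x y hxy
    exact h3 (smul_right_injective _ (inv_ne_zero hd) hxy)
  · intro v
    rw [← h4 v]
    constructor
    · intro h
      have := hC.smul d hd _ h
      rwa [smul_smul, mul_inv_cancel₀ hd, one_smul] at this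
    · exact hC.smul _ (inv_ne_zero hd) _
  · exact mul_ne_zero (inv_ne_zero hd) hc
  · simp [h5, smul_smul]
  · simp [h6, smul_smul, inv_mul_cancel₀ hd]

open Submodule in
theorem line_eq {F V : Type*} [Field F] [AddCommGroup V] [Module F V] [FiniteDimensional F V]
    (W : Submodule F V) (hW : Module.finrank F W = 2) {u w : V} (hu : u ∈ W) (hw : w ∈ W)
    (hu0 : u ≠ 0) (hwu : w ∉ span F {u}) : span F {u} ⊔ span F {w} = W := by
  apply eq_of_le_of_finrank_eq
  · exact sup_le ((span_singleton_le_iff_mem _ _).2 hu) ((span_singleton_le_iff_mem _ _).2 hw)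
  · rw [finrank_add_one _ hwu, finrank_span_singleton hu0, hW]

open Submodule in
theorem line_comb {F V : Type*} [Field F] [AddCommGroup V] [Module F V] [FiniteDimensional F V]
    (W : Submodule F V) (hW : Module.finrank F W = 2) {u w : V} (hu : u ∈ W) (hw : w ∈ W)
    (hu0 : u ≠ 0) (hwu : w ∉ span F {u}) {z : V} (hz : z ∈ W) :
    ∃ a b : F, z = a • u + b • w := by
  rw [← line_eq W hW hu hw hu0 hwu, mem_sup] at hz
  obtain ⟨y, hy, t, ht, rfl⟩ := hz
  obtain ⟨a, rfl⟩ := mem_span_singleton.1 hy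
  obtain ⟨b, rfl⟩ := mem_span_singleton.1 ht
  exact ⟨a, b, rfl⟩

theorem Good.mixed_le {F V : Type*} [Field F] [AddCommGroup V] [Module F V]
    [FiniteDimensional F V] [Finite V] {C : Set V}
    (hC : Good F C) (W W' : Submodule F V) (hW : Module.finrank F W = 2)
    (h1 : (C ∩ W).Nonempty) (h2 : (coCone C ∩ W).Nonempty)
    (h3 : (C ∩ W').Nonempty) (h4 : (coCone C ∩ W').Nonempty) :
    (C ∩ W).ncard ≤ (C ∩ W').ncard := by
  obtain ⟨u, hu, huW⟩ := h1
  obtain ⟨w, hw, hwW⟩ := h2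
  obtain ⟨u', hu', huW'⟩ := h3
  obtain ⟨w', hw', hwW'⟩ := h4
  obtain ⟨φ, g, k1, k2, k3, k4, ⟨c, hc, k5⟩, ⟨d, hd, k6⟩⟩ := hC.trans u hu w hw u' hu' w' hw'
  apply Set.ncard_le_ncard_of_injOn g
  · rintro z ⟨hz, hzW⟩
    refine ⟨(k4 z).2 hz, ?_⟩
    obtain ⟨a, b, rfl⟩ := line_comb W hW huW hwW (hC.ne hu) (hC.not_mem_span hu hw) hzW
    rw [k1, k2, k2, k5, k6]
    exact W'.add_mem (W'.smul_mem _ (W'.smul_mem _ huW')) (W'.smul_mem _ (W'.smul_mem _ hwW'))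
  · exact k3.injOn

/-- a cone has a multiple of `q-1` elements; the number of points is that of the image. -/
theorem IsCone.card {F V : Type*} [Field F] [AddCommGroup V] [Module F V]
    [FiniteDimensional F V] [Finite V] {C : Set V} (hC : IsCone F C) {q : ℕ}
    (hq : Nat.card F = q) :
    C.ncard = (q - 1) * ((fun v => (⊥ : Submodule F V) ⊔ Submodule.span F {v}) '' C).ncard := by
  apply part_count
  · intro v hv h
    exact hC.ne hv ((Submodule.mem_bot F).1 h)
  · intro v hv
    rw [bot_sup_eq]
    exact span_inter_card hq C hC.zero hC.smul hv

theorem IsCone.inter {F V : Type*} [Field F] [AddCommGroup V] [Module F V]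
    {C : Set V} (hC : IsCone F C) (U : Submodule F V) : IsCone F (C ∩ U) where
  zero := fun h => hC.zero h.1
  smul := fun c hc v hv => ⟨hC.smul c hc v hv.1, U.smul_mem c hv.2⟩

theorem IsCone.add_card {F V : Type*} [Field F] [AddCommGroup V] [Module F V]
    [FiniteDimensional F V] [Finite V] {C : Set V} (hC : IsCone F C) {q : ℕ}
    (hq : Nat.card F = q) (U : Submodule F V) :
    (C ∩ U).ncard + (coCone C ∩ U).ncard + 1 = q ^ Module.finrank F U := by
  rw [← sub_card hq, ← Set.ncard_union_eq]
  · have e : (U : Set V) \ {0} = (C ∩ U) ∪ (coCone C ∩ U) := by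
      ext v
      constructor
      · rintro ⟨h1, h2⟩
        by_cases h : v ∈ C
        · exact Or.inl ⟨h, h1⟩
        · exact Or.inr ⟨⟨h2, h⟩, h1⟩
      · rintro (⟨h1, h2⟩ | ⟨h1, h2⟩)
        · exact ⟨h2, hC.ne h1⟩
        · exact ⟨h2, h1.1⟩
    rw [← e, Set.ncard_sdiff_singleton_add_one (U.zero_mem)]
  · rw [Set.disjoint_left]
    rintro v ⟨h1, _⟩ ⟨h2, _⟩
    exact h2.2 h1

/-- class `[0,x,q+1]`. -/
def IsClass (F : Type*) {V : Type*} [Field F] [AddCommGroup V] [Module F V] (C : Set V)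
    (q x : ℕ) : Prop :=
  ∀ W : Submodule F V, Module.finrank F W = 2 → (C ∩ W).Nonempty → (coCone C ∩ W).Nonempty →
    (C ∩ W).ncard = (q - 1) * x

theorem IsClass.co {F V : Type*} [Field F] [AddCommGroup V] [Module F V]
    [FiniteDimensional F V] [Finite V] {C : Set V} (hC : IsCone F C) {q x : ℕ}
    (hq : Nat.card F = q) (hq2 : 2 ≤ q) (hx : x ≤ q) (h : IsClass F C q x) :
    IsClass F (coCone C) q (q + 1 - x) := by
  intro W hW h1 h2
  rw [hC.co_co] at h2
  have e1 := h W hW h2 h1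
  have e2 := hC.add_card hq W
  rw [e1, hW] at e2
  obtain ⟨t, rfl⟩ : ∃ t, q = t + 1 := ⟨q - 1, by omega⟩
  obtain ⟨y, hy⟩ : ∃ y, t + 1 + 1 = x + y := ⟨t + 1 + 1 - x, by omega⟩
  rw [show t + 1 + 1 - x = y by omega]
  simp only [Nat.add_sub_cancel] at e2 ⊢
  have : t * (t + 1 + 1) = t * x + t * y := by rw [hy]; ring
  nlinarith

theorem Good.exists_class {F V : Type*} [Field F] [AddCommGroup V] [Module F V]
    [FiniteDimensional F V] [Finite V] {C : Set V} (hC : Good F C) {q : ℕ}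
    (hq : Nat.card F = q) (hq2 : 2 ≤ q) (h1 : C.Nonempty) (h2 : (coCone C).Nonempty) :
    ∃ x, 1 ≤ x ∧ x ≤ q ∧ IsClass F C q x := by
  obtain ⟨u, hu⟩ := h1
  obtain ⟨w, hw⟩ := h2
  let W : Submodule F V := Submodule.span F {u} ⊔ Submodule.span F {w}
  have hW : Module.finrank F W = 2 := by
    rw [finrank_add_one _ (hC.not_mem_span hu hw), finrank_span_singleton (hC.ne hu)]
  have huW : (C ∩ W).Nonempty :=
    ⟨u, hu, Submodule.mem_sup_left (Submodule.mem_span_singleton_self u)⟩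
  have hwW : (coCone C ∩ W).Nonempty :=
    ⟨w, hw, Submodule.mem_sup_right (Submodule.mem_span_singleton_self w)⟩
  have e := (hC.toIsCone.inter W).card hq
  have e' := (hC.toIsCone.co.inter W).card hq
  have e2 := hC.toIsCone.add_card hq W
  have p1 := (Set.ncard_pos (Set.toFinite _)).2 huW
  have p2 := (Set.ncard_pos (Set.toFinite _)).2 hwW
  rw [hW] at e2
  set x := ((fun v => (⊥ : Submodule F V) ⊔ Submodule.span F {v}) '' (C ∩ W)).ncard
  set y := ((fun v => (⊥ : Submodule F V) ⊔ Submodule.span F {v}) '' (coCone C ∩ W)).ncard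
  refine ⟨x, ?_, ?_, ?_⟩
  · by_contra h
    rw [e, show x = 0 by omega] at p1
    simp at p1
  · have hy : 1 ≤ y := by
      by_contra h
      rw [e', show y = 0 by omega] at p2
      simp at p2
    rw [e, e'] at e2
    obtain ⟨t, rfl⟩ : ∃ t, q = t + 1 := ⟨q - 1, by omega⟩
    simp only [Nat.add_sub_cancel] at e2
    have : t * (x + y) = t * (t + 2) := by nlinarith
    have := Nat.eq_of_mul_eq_mul_left (by omega) this
    omega
  · intro W' hW' h1 h2
    rw [← e]
    exact le_antisymm (hC.mixed_le W' W hW' h1 h2 huW hwW) (hC.mixed_le W W' hW huW hwW h1 h2)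

/-- `x = 1`: a subspace. -/
theorem class_one {F V : Type*} [Field F] [AddCommGroup V] [Module F V]
    [FiniteDimensional F V] [Finite V] {C : Set V} (hC : IsCone F C) {q : ℕ}
    (hq : Nat.card F = q) (h : IsClass F C q 1) :
    ∃ S : Submodule F V, ∀ v, v ∈ S ↔ v = 0 ∨ v ∈ C := by
  refine ⟨{ carrier := {v | v = 0 ∨ v ∈ C}
            zero_mem' := Or.inl rfl
            smul_mem' := ?_
            add_mem' := ?_ }, fun v => Iff.rfl⟩
  · rintro u v hu hv
    rcases hu with rfl | hu
    · simpa using hv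
    rcases hv with rfl | hv
    · simpa using Or.inr hu
    by_cases hs : v ∈ Submodule.span F {u}
    · obtain ⟨c, rfl⟩ := Submodule.mem_span_singleton.1 hs
      by_cases hc : 1 + c = 0
      · left; rw [← one_smul F u, smul_smul, mul_one, ← add_smul, hc, zero_smul]
      · right
        have := hC.smul _ hc u hu
        rwa [add_smul, one_smul] at this
    · let W : Submodule F V := Submodule.span F {u} ⊔ Submodule.span F {v}
      have huW : u ∈ W := Submodule.mem_sup_left (Submodule.mem_span_singleton_self u)
      have hvW : v ∈ W := Submodule.mem_sup_right (Submodule.mem_span_singleton_self v)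
      by_contra hc
      change ¬ (u + v = 0 ∨ u + v ∈ C) at hc
      push Not at hc
      have := h W (by rw [finrank_add_one _ hs, finrank_span_singleton (hC.ne hu)])
        ⟨u, hu, huW⟩ ⟨u + v, hc, W.add_mem huW hvW⟩
      rw [mul_one, ← span_inter_card hq C hC.zero hC.smul hu] at this
      have e := Set.eq_of_subset_of_ncard_le (s := C ∩ (Submodule.span F {u} : Submodule F V))
        (t := C ∩ W) (Set.inter_subset_inter_right _ (SetLike.coe_subset_coe.2 le_sup_left))
        this.le
      have hv' : v ∈ C ∩ W := ⟨hv, hvW⟩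
      rw [← e] at hv'
      exact hs hv'.2
  · rintro c v (rfl | hv)
    · exact Or.inl (smul_zero c)
    · by_cases hc : c = 0
      · exact Or.inl (by simp [hc])
      · exact Or.inr (hC.smul c hc v hv)

theorem plane_card {F V : Type*} [Field F] [AddCommGroup V] [Module F V]
    [FiniteDimensional F V] [Finite V] {C : Set V} (hC : IsCone F C) {q x : ℕ}
    (hq : Nat.card F = q) (hq2 : 2 ≤ q) (hx : 2 ≤ x) (h : IsClass F C q x)
    (U : Submodule F V) (hU : Module.finrank F U = 3) (h1 : (C ∩ U).Nonempty)
    (hf : ∀ W : Submodule F V, W ≤ U → Module.finrank F W = 2 → (coCone C ∩ W).Nonempty) :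
    (C ∩ U).ncard = (q - 1) * (1 + (x - 1) * (q + 1)) := by
  obtain ⟨u, hu, huU⟩ := h1
  obtain ⟨N, hN1, hN2⟩ := count_in hq hq2 hx C hC U hu huU
    (fun W hW hWU huW => h W hW ⟨u, hu, huW⟩ (hf W hWU hW))
  rw [hU] at hN1
  have : N = q + 1 := by
    obtain ⟨t, rfl⟩ : ∃ t, q = t + 1 := ⟨q - 1, by omega⟩
    rw [show (t + 1) ^ 2 - (t + 1) = (t + 1) * t by
      rw [show (t + 1) ^ 2 = (t + 1) * t + (t + 1) by ring]; omega] at hN1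
    have : (t + 1) * t * N = (t + 1) * t * (t + 1 + 1) := by nlinarith
    exact Nat.eq_of_mul_eq_mul_left (by have : 1 ≤ t := by omega
                                        positivity) this
  rw [hN2, this]
  ring

theorem plane_dvd {F V : Type*} [Field F] [AddCommGroup V] [Module F V]
    [FiniteDimensional F V] [Finite V] {C : Set V} (hC : IsCone F C) {q x : ℕ}
    (hq : Nat.card F = q) (hq2 : 2 ≤ q) (hx : 2 ≤ x) (h : IsClass F C q x)
    (U : Submodule F V) (hU : Module.finrank F U = 3) (h1 : (C ∩ U).Nonempty)
    (h2 : (coCone C ∩ U).Nonempty)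
    (hf : ∀ W : Submodule F V, W ≤ U → Module.finrank F W = 2 → (coCone C ∩ W).Nonempty) :
    x ∣ q := by
  have e1 := plane_card hC hq hq2 hx h U hU h1 hf
  obtain ⟨w, hw, hwU⟩ := h2
  have e2 := count_out C hC U hw.1 hw.2 hwU
    (fun W hW _ hwW hne => h W hW hne ⟨w, hw, hwW⟩)
  rw [e1, mul_assoc] at e2
  have e3 := Nat.eq_of_mul_eq_mul_left (by omega) e2
  set N := ((fun v => Submodule.span F {w} ⊔ Submodule.span F {v}) ''
    ((C ∩ U) \ (Submodule.span F {w} : Submodule F V))).ncard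
  have e4 : x * (q + 1) = q + x * N := by
    rw [← e3]
    obtain ⟨y, rfl⟩ : ∃ y, x = y + 1 := ⟨x - 1, by omega⟩
    simp only [Nat.add_sub_cancel]
    ring
  exact (Nat.dvd_add_left (dvd_mul_right x _)).1 (e4 ▸ dvd_mul_right x (q + 1))

theorem lines_meet {F V : Type*} [Field F] [AddCommGroup V] [Module F V]
    [FiniteDimensional F V] (U W W' : Submodule F V) (hU : Module.finrank F U = 3)
    (hW : Module.finrank F W = 2) (hW' : Module.finrank F W' = 2) (h : W ≤ U) (h' : W' ≤ U) :
    ∃ z, z ≠ 0 ∧ z ∈ W ∧ z ∈ W' := by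
  have h1 := Submodule.finrank_sup_add_finrank_inf_eq W W'
  have h2 := Submodule.finrank_mono (sup_le h h')
  have : W ⊓ W' ≠ ⊥ := by
    intro hb
    rw [hb, finrank_bot] at h1
    omega
  obtain ⟨z, hz, hz0⟩ := Submodule.exists_mem_ne_zero_of_ne_bot this
  exact ⟨z, hz0, hz.1, hz.2⟩

theorem plane_dich {F V : Type*} [Field F] [AddCommGroup V] [Module F V]
    [FiniteDimensional F V] [Finite V] {C : Set V} (hC : IsCone F C) {q x : ℕ}
    (hq : Nat.card F = q) (hq2 : 2 ≤ q) (hx : 2 ≤ x) (hxq : x + 1 ≤ q) (h : IsClass F C q x)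
    (U : Submodule F V) (hU : Module.finrank F U = 3) (h1 : (C ∩ U).Nonempty)
    (h2 : (coCone C ∩ U).Nonempty) :
    (x ∣ q ∧ ∀ W : Submodule F V, W ≤ U → Module.finrank F W = 2 → (coCone C ∩ W).Nonempty) ∨
    (q + 1 - x ∣ q ∧ ∀ W : Submodule F V, W ≤ U → Module.finrank F W = 2 → (C ∩ W).Nonempty) := by
  by_cases hf : ∀ W : Submodule F V, W ≤ U → Module.finrank F W = 2 → (coCone C ∩ W).Nonempty
  · exact Or.inl ⟨plane_dvd hC hq hq2 hx h U hU h1 h2 hf, hf⟩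
  · right
    push Not at hf
    obtain ⟨W, hWU, hW, he⟩ := hf
    have hf' : ∀ W : Submodule F V, W ≤ U → Module.finrank F W = 2 → (C ∩ W).Nonempty := by
      intro W' hWU' hW'
      obtain ⟨z, hz0, hz, hz'⟩ := lines_meet U W W' hU hW hW' hWU hWU'
      refine ⟨z, ?_, hz'⟩
      by_contra hzC
      have : z ∈ coCone C ∩ (W : Set V) := ⟨⟨hz0, hzC⟩, hz⟩
      rw [he] at this
      exact this
    refine ⟨?_, hf'⟩
    refine plane_dvd hC.co hq hq2 (by omega) (h.co hC hq hq2 (by omega)) U hU h2 ?_ ?_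
    · rwa [hC.co_co]
    · rwa [hC.co_co]

theorem arc_dich {F V : Type*} [Field F] [AddCommGroup V] [Module F V]
    [FiniteDimensional F V] [Finite V] {C : Set V} (hC : IsCone F C) {q x p a : ℕ}
    (hp : p.Prime) (hpa : q = p ^ a)
    (hq : Nat.card F = q) (hq2 : 2 ≤ q) (hx : 2 ≤ x) (hxq : x + 1 ≤ q) (h : IsClass F C q x)
    (hn : 3 ≤ Module.finrank F V) (h1 : C.Nonempty) (h2 : (coCone C).Nonempty) :
    (x ∣ q ∧ ∀ W : Submodule F V, Module.finrank F W = 2 → (coCone C ∩ W).Nonempty) ∨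
    (q + 1 - x ∣ q ∧ ∀ W : Submodule F V, Module.finrank F W = 2 → (C ∩ W).Nonempty) := by
  have hnot : ¬ (x ∣ q ∧ q + 1 - x ∣ q) := by
    rintro ⟨k1, k2⟩
    rw [hpa] at k1 k2
    obtain ⟨i, _, hi⟩ := (Nat.dvd_prime_pow hp).1 k1
    obtain ⟨j, _, hj⟩ := (Nat.dvd_prime_pow hp).1 k2
    have hi0 : i ≠ 0 := by rintro rfl; simp at hi; omega
    have hj0 : j ≠ 0 := by rintro rfl; simp at hj; omega
    have ha0 : a ≠ 0 := by rintro rfl; simp at hpa; omega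
    have d1 : p ∣ x := hi ▸ dvd_pow_self p hi0
    have d2 : p ∣ q + 1 - x := by rw [hpa, hj]; exact dvd_pow_self p hj0
    have d3 : p ∣ q := hpa ▸ dvd_pow_self p ha0
    have d4 : p ∣ q + 1 := by
      have := dvd_add d1 d2
      rwa [show x + (q + 1 - x) = q + 1 by omega] at this
    have := (Nat.dvd_add_right d3).1 d4
    exact hp.one_lt.ne' (Nat.dvd_one.1 this)
  obtain ⟨u, hu⟩ := h1
  obtain ⟨w, hw⟩ := h2
  -- extension of a line by a point off the line
  have ext3 : ∀ (W : Submodule F V) (z : V), Module.finrank F W = 2 → z ∉ W →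
      Module.finrank F (W ⊔ Submodule.span F {z} : Submodule F V) = 3 := by
    intro W z hW hz
    rw [finrank_add_one _ hz, hW]
  obtain ⟨U, hU, hu', hw'⟩ : ∃ U : Submodule F V, Module.finrank F U = 3 ∧ u ∈ U ∧ w ∈ U := by
    let W : Submodule F V := Submodule.span F {u} ⊔ Submodule.span F {w}
    have hW : Module.finrank F W = 2 := by
      rw [finrank_add_one _ (hC.not_mem_span hu hw), finrank_span_singleton (hC.ne hu)]
    have : ∃ z, z ∉ W := by
      by_contra hc
      push Not at hc
      have : W = ⊤ := Submodule.eq_top_iff'.2 hc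
      rw [this, finrank_top] at hW
      omega
    obtain ⟨z, hz⟩ := this
    exact ⟨_, ext3 W z hW hz,
      Submodule.mem_sup_left (Submodule.mem_sup_left (Submodule.mem_span_singleton_self u)),
      Submodule.mem_sup_left (Submodule.mem_sup_right (Submodule.mem_span_singleton_self w))⟩
  rcases plane_dich hC hq hq2 hx hxq h U hU ⟨u, hu, hu'⟩ ⟨w, hw, hw'⟩ with ⟨k, -⟩ | ⟨k, -⟩
  · refine Or.inl ⟨k, fun W hW => ?_⟩
    by_contra hc
    have hwW : w ∉ W := fun hwW => hc ⟨w, hw, hwW⟩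
    obtain ⟨z, hz, hz0⟩ : ∃ z ∈ W, z ≠ 0 := Submodule.exists_mem_ne_zero_of_ne_bot (by
      rintro rfl; simp at hW)
    have hzC : z ∈ C := by
      by_contra hzC
      exact hc ⟨z, ⟨hz0, hzC⟩, hz⟩
    rcases plane_dich hC hq hq2 hx hxq h _ (ext3 W w hW hwW) ⟨z, hzC, Submodule.mem_sup_left hz⟩
      ⟨w, hw, Submodule.mem_sup_right (Submodule.mem_span_singleton_self w)⟩ with k' | k'
    · exact hc (k'.2 W le_sup_left hW)
    · exact hnot ⟨k, k'.1⟩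
  · refine Or.inr ⟨k, fun W hW => ?_⟩
    by_contra hc
    have huW : u ∉ W := fun huW => hc ⟨u, hu, huW⟩
    obtain ⟨z, hz, hz0⟩ : ∃ z ∈ W, z ≠ 0 := Submodule.exists_mem_ne_zero_of_ne_bot (by
      rintro rfl; simp at hW)
    have hzC : z ∈ coCone C := ⟨hz0, fun h => hc ⟨z, h, hz⟩⟩
    rcases plane_dich hC hq hq2 hx hxq h _ (ext3 W u hW huW)
      ⟨u, hu, Submodule.mem_sup_right (Submodule.mem_span_singleton_self u)⟩
      ⟨z, hzC, Submodule.mem_sup_left hz⟩ with k' | k'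
    · exact hnot ⟨k'.1, k⟩
    · exact hc (k'.2 W le_sup_left hW)

theorem x_eq_two {F V : Type*} [Field F] [Fintype F] [AddCommGroup V] [Module F V]
    [FiniteDimensional F V] [Finite V] {C : Set V} (hC : Good F C) {q x p a : ℕ}
    (hp : p.Prime) (hpa : q = p ^ a)
    (hq : Nat.card F = q) (hq2 : 2 ≤ q) (hx : 2 ≤ x) (hxq : x + 1 ≤ q) (h : IsClass F C q x)
    (h1 : C.Nonempty) (h2 : (coCone C).Nonempty) (hdvd : x ∣ q) : x = 2 := by
  have hq' : Fintype.card F = q := by rw [← Nat.card_eq_fintype_card, hq]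
  have haut := autCard (F := F) p a hp (hq'.trans hpa)
  obtain ⟨u, hu⟩ := h1
  obtain ⟨w, hw⟩ := h2
  let W : Submodule F V := Submodule.span F {u} ⊔ Submodule.span F {w}
  have hwu := hC.not_mem_span hu hw
  have hW : Module.finrank F W = 2 := by
    rw [finrank_add_one _ hwu, finrank_span_singleton (hC.ne hu)]
  have huW : u ∈ W := Submodule.mem_sup_left (Submodule.mem_span_singleton_self u)
  have hwW : w ∈ W := Submodule.mem_sup_right (Submodule.mem_span_singleton_self w)
  let i : (Fin 2 → F) →ₗ[F] V :=
    (LinearMap.proj 0).smulRight u + (LinearMap.proj 1).smulRight w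
  have hi : ∀ d, i d = d 0 • u + d 1 • w := fun d => rfl
  have hiW : ∀ d, i d ∈ W := fun d => W.add_mem (W.smul_mem _ huW) (W.smul_mem _ hwW)
  have hiS : ∀ z ∈ W, ∃ d, i d = z := by
    intro z hz
    obtain ⟨α, β, rfl⟩ := line_comb W hW huW hwW (hC.ne hu) hwu hz
    exact ⟨![α, β], by simp [hi]⟩
  have hinj : Function.Injective i := by
    rw [← LinearMap.ker_eq_bot, LinearMap.ker_eq_bot']
    intro d hd
    rw [hi] at hd
    have hd1 : d 1 = 0 := by
      by_contra hne
      apply hwu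
      rw [Submodule.mem_span_singleton]
      refine ⟨-((d 1)⁻¹ * d 0), ?_⟩
      have e1 : d 1 • w = -(d 0 • u) := by rw [eq_neg_iff_add_eq_zero, add_comm]; exact hd
      have := congrArg (fun z => (d 1)⁻¹ • z) e1
      simp only [smul_smul, inv_mul_cancel₀ hne, one_smul, smul_neg] at this
      rw [this, neg_smul]
    have hd0 : d 0 = 0 := by
      rw [hd1, zero_smul, add_zero] at hd
      exact (smul_eq_zero.1 hd).resolve_right (hC.ne hu)
    funext j
    fin_cases j
    · exact hd0
    · exact hd1
  obtain ⟨t, ht⟩ := LinearMap.exists_leftInverse_of_injective i (LinearMap.ker_eq_bot.2 hinj)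
  have ht' : ∀ d, t (i d) = d := fun d => LinearMap.congr_fun ht d
  have hit : ∀ z ∈ W, i (t z) = z := by
    intro z hz
    obtain ⟨d, rfl⟩ := hiS z hz
    rw [ht']
  let D : Set (Fin 2 → F) := {d | i d ∈ coCone C}
  have hDcard : D.ncard = (q - 1) * (q + 1 - x) := by
    rw [← Set.ncard_image_of_injective D hinj]
    have : i '' D = coCone C ∩ W := by
      ext z
      constructor
      · rintro ⟨d, hd, rfl⟩
        exact ⟨hd, hiW d⟩
      · rintro ⟨hz, hzW⟩
        obtain ⟨d, rfl⟩ := hiS z hzW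
        exact ⟨d, hz, rfl⟩
    rw [this]
    apply h.co hC.toIsCone hq hq2 (by omega) W hW
    · exact ⟨w, hw, hwW⟩
    · rw [hC.toIsCone.co_co]; exact ⟨u, hu, huW⟩
  have key := orbit_dvd q a hq' haut D ⟨t w, by
      change i (t w) ∈ coCone C; rw [hit w hwW]; exact hw⟩ (by
    intro d hd d' hd'
    obtain ⟨φ, g, k1, k2, k3, k4, ⟨c, hc, k5⟩, k6⟩ := hC.trans' u hu (i d) hd u hu (i d') hd'
    have hgW : ∀ z ∈ W, g z ∈ W := by
      intro z hz
      obtain ⟨α, β, rfl⟩ := line_comb W hW huW (hiW d) (hC.ne hu) (hC.not_mem_span hu hd) hz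
      rw [k1, k2, k2, k5, k6]
      exact W.add_mem (W.smul_mem _ (W.smul_mem _ huW)) (W.smul_mem _ (hiW d'))
    refine ⟨φ, fun e => t (g (i e)), ?_, ?_, ?_, ?_, ?_⟩
    · intro y z; simp [k1]
    · intro b y; simp [k2]
    · intro y z hyz
      have := congrArg i hyz
      simp only at this
      rw [hit _ (hgW _ (hiW y)), hit _ (hgW _ (hiW z))] at this
      exact hinj (k3 this)
    · intro e he
      change i (t (g (i e))) ∈ coCone C
      rw [hit _ (hgW _ (hiW e))]
      refine ⟨?_, fun hh => he.2 ((k4 _).1 hh)⟩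
      intro h0
      exact he.1 (k3 (h0.trans (map_zero_of_add g k1).symm))
    · simp only [k6, ht'])
  rw [hDcard] at key
  have e1 : (q ^ 2 - 1) * (q ^ 2 - q) * a = (q - 1) * (a * (q ^ 2 - 1) * q) := by
    rw [show q ^ 2 - q = (q - 1) * q by rw [Nat.sub_mul, one_mul, sq]]
    ring
  rw [e1] at key
  have key2 := Nat.dvd_of_mul_dvd_mul_left (by omega) key
  obtain ⟨j, hja, hj⟩ := (Nat.dvd_prime_pow hp).1 (hpa ▸ hdvd)
  rw [hj]
  apply arith5 p a j hp
  · by_contra hc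
    rw [show j = 0 by omega] at hj
    simp at hj; omega
  · by_contra hc
    rw [show j = a by omega, ← hpa] at hj
    omega
  · rw [← hpa, ← hj]; exact key2

theorem no_dim4 {F V : Type*} [Field F] [AddCommGroup V] [Module F V]
    [FiniteDimensional F V] [Finite V] {C : Set V} (hC : IsCone F C) {q : ℕ}
    (hq : Nat.card F = q) (hq3 : 3 ≤ q) (h : IsClass F C q 2)
    (hf : ∀ W : Submodule F V, Module.finrank F W = 2 → (coCone C ∩ W).Nonempty)
    (hn : 4 ≤ Module.finrank F V) (h1 : C.Nonempty) (h2 : (coCone C).Nonempty) : False := by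
  have hq2 : 2 ≤ q := by omega
  have ext_ex : ∀ W : Submodule F V, Module.finrank F W < 4 → ∃ z, z ∉ W := by
    intro W hW
    by_contra hc
    push Not at hc
    have : W = ⊤ := Submodule.eq_top_iff'.2 hc
    rw [this, finrank_top] at hW
    omega
  obtain ⟨u, hu⟩ := h1
  obtain ⟨w, hw⟩ := h2
  let W : Submodule F V := Submodule.span F {u} ⊔ Submodule.span F {w}
  have hW : Module.finrank F W = 2 := by
    rw [finrank_add_one _ (hC.not_mem_span hu hw), finrank_span_singleton (hC.ne hu)]
  have huW : u ∈ W := Submodule.mem_sup_left (Submodule.mem_span_singleton_self u)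
  have hwW : w ∈ W := Submodule.mem_sup_right (Submodule.mem_span_singleton_self w)
  obtain ⟨z, hz⟩ := ext_ex W (by omega)
  let P : Submodule F V := W ⊔ Submodule.span F {z}
  have hP : Module.finrank F P = 3 := by rw [finrank_add_one _ hz, hW]
  have huP : u ∈ P := Submodule.mem_sup_left huW
  have hwP : w ∈ P := Submodule.mem_sup_left hwW
  obtain ⟨z', hz'⟩ := ext_ex P (by omega)
  let U : Submodule F V := P ⊔ Submodule.span F {z'}
  have hU : Module.finrank F U = 4 := by rw [finrank_add_one _ hz', hP]
  have hPU : P ≤ U := le_sup_left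
  have cP : ∀ P : Submodule F V, Module.finrank F P = 3 → (C ∩ P).Nonempty →
      (C ∩ P).ncard = (q - 1) * (q + 2) := by
    intro P hP hne
    rw [plane_card hC hq hq2 le_rfl h P hP hne (fun W _ hW => hf W hW)]
    ring
  -- an exterior line
  obtain ⟨M, hMP, hM, hMe⟩ : ∃ M : Submodule F V, M ≤ P ∧ Module.finrank F M = 2 ∧
      C ∩ (M : Set V) = ∅ := by
    by_contra hc
    push Not at hc
    have e1 := cP P hP ⟨u, hu, huP⟩
    have hle := (Submodule.span_singleton_le_iff_mem w P).2 hwP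
    have e2 := count_out C hC P hw.1 hw.2 hwP
      (fun W hW _ hwW hne => h W hW hne ⟨w, hw, hwW⟩)
    have e3 := count_all hq (Submodule.span F {w}) P hle
    rw [image_eq C _ P hle ?_, e1] at e2
    · rw [finrank_span_singleton hw.1, hP] at e3
      set N := ((fun v => Submodule.span F {w} ⊔ Submodule.span F {v}) ''
        ((P : Set V) \ (Submodule.span F {w} : Submodule F V))).ncard
      obtain ⟨s, rfl⟩ : ∃ s, q = s + 1 := ⟨q - 1, by omega⟩
      rw [mul_assoc] at e2
      have e4 := Nat.eq_of_mul_eq_mul_left (by omega) e2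
      rw [show (s + 1) ^ (1 + 1) - (s + 1) ^ 1 = (s + 1) * s by
        rw [show (s + 1) ^ (1 + 1) = (s + 1) * s + (s + 1) ^ 1 by ring]; omega] at e3
      have e5 : ((s + 1) * s) * N = ((s + 1) * s) * (s + 2) := by nlinarith
      have := Nat.eq_of_mul_eq_mul_left (by have : 1 ≤ s := by omega
                                            positivity) e5
      omega
    · intro v hv hvw
      have hr : Module.finrank F (Submodule.span F {w} ⊔ Submodule.span F {v} : Submodule F V) = 2 := by
        rw [finrank_add_one _ hvw, finrank_span_singleton hw.1]
      obtain ⟨y, hy, hyW⟩ := hc _ (sup_le hle ((Submodule.span_singleton_le_iff_mem _ _).2 hv)) hr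
      refine ⟨y, hy, hyW, ?_⟩
      refine hC.co.not_mem_span hw ?_
      rwa [hC.co_co]
  -- count `C ∩ U` in two ways
  obtain ⟨N, hN1, hN2⟩ := count_in hq hq2 le_rfl C hC U hu (hPU huP)
    (fun W hW hWU huW => h W hW ⟨u, hu, huW⟩ (hf W hW))
  have e1 := count_part C M U (hMP.trans hPU) ((q - 1) * (q + 2)) (by
    intro v hv hvU hvM
    rw [hMe, Set.ncard_empty, zero_add]
    apply cP
    · rw [finrank_add_one _ hvM, hM]
    · exact ⟨v, hv, Submodule.mem_sup_right (Submodule.mem_span_singleton_self v)⟩)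
  rw [hMe, Set.ncard_empty, zero_add, hN2] at e1
  rw [hU] at hN1
  set N' := ((fun v => M ⊔ Submodule.span F {v}) '' ((C ∩ U) \ M)).ncard
  obtain ⟨s, rfl⟩ : ∃ s, q = s + 1 := ⟨q - 1, by omega⟩
  simp only [Nat.add_sub_cancel] at e1
  rw [show (s + 1) ^ 2 - (s + 1) = (s + 1) * s by
        rw [show (s + 1) ^ 2 = (s + 1) * s + (s + 1) by ring]; omega] at hN1
  have e5 : ((s + 1) * s) * N = ((s + 1) * s) * ((s + 1) ^ 2 + (s + 1) + 1) := by nlinarith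
  have hs : 1 ≤ s := by omega
  have e6 := Nat.eq_of_mul_eq_mul_left (by positivity) e5
  have e7 : s * ((s + 1) ^ 2 + (s + 1) + 2) = s * ((s + 3) * N') := by
    rw [e6] at e1; nlinarith
  have e8 := Nat.eq_of_mul_eq_mul_left (by omega) e7
  have e9 : (s + 3) * s + 4 = (s + 3) * N' := by rw [← e8]; ring
  have e10 : s + 3 ∣ 4 := (Nat.dvd_add_right (dvd_mul_right (s + 3) s)).1 (e9 ▸ dvd_mul_right _ _)
  have := Nat.le_of_dvd (by norm_num) e10
  omega

theorem no_big {F V : Type*} [Field F] [Fintype F] [AddCommGroup V] [Module F V]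
    [FiniteDimensional F V] [Finite V] {C : Set V} (hC : Good F C) {q a : ℕ}
    (hpa : q = 2 ^ a) (ha : 3 ≤ a)
    (hq : Nat.card F = q) (h : IsClass F C q 2)
    (hf : ∀ W : Submodule F V, Module.finrank F W = 2 → (coCone C ∩ W).Nonempty)
    (hn : Module.finrank F V = 3) (h1 : C.Nonempty) (h2 : (coCone C).Nonempty) : False := by
  have hq' : Fintype.card F = q := by rw [← Nat.card_eq_fintype_card, hq]
  have haut := autCard (F := F) 2 a Nat.prime_two (hq'.trans hpa)
  have hq2 : 2 ≤ q := by
    rw [hpa]; exact le_self_pow₀ (by norm_num) (by omega)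
  obtain ⟨u, hu⟩ := h1
  obtain ⟨w, hw⟩ := h2
  let M : Submodule F V := Submodule.span F {w}
  have hfr : Module.finrank F (V ⧸ M) = Module.finrank F (Fin 2 → F) := by
    have := Submodule.finrank_quotient_add_finrank M
    rw [finrank_span_singleton hw.1, hn] at this
    rw [Module.finrank_fin_fun]
    omega
  let e := LinearEquiv.ofFinrankEq (V ⧸ M) (Fin 2 → F) hfr
  let π : V →ₗ[F] (Fin 2 → F) := e.toLinearMap.comp M.mkQ
  have hker : LinearMap.ker π = M := by
    rw [LinearMap.ker_comp_of_ker_eq_bot _ (LinearEquiv.ker e), Submodule.ker_mkQ]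
  have hsurj : Function.Surjective π := e.surjective.comp M.mkQ_surjective
  obtain ⟨ρ, hρ⟩ := LinearMap.exists_rightInverse_of_surjective π (LinearMap.range_eq_top.2 hsurj)
  have hρ' : ∀ d, π (ρ d) = d := fun d => LinearMap.congr_fun hρ d
  have hπ0 : ∀ z, π z = 0 ↔ z ∈ M := fun z => by rw [← hker, LinearMap.mem_ker]
  have hCM : ∀ z ∈ C, z ∉ M := by
    intro z hz
    exact hC.co.not_mem_span hw (by rwa [hC.co_co])
  let D : Set (Fin 2 → F) := π '' C
  have hD : IsCone F D := by
    constructor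
    · rintro ⟨z, hz, hz0⟩
      exact hCM z hz ((hπ0 z).1 hz0)
    · rintro c hc _ ⟨z, hz, rfl⟩
      exact ⟨c • z, hC.smul c hc z hz, map_smul _ _ _⟩
  -- count
  have hDc := hD.card hq
  have e1 := plane_card hC.toIsCone hq hq2 le_rfl h ⊤ (by rw [finrank_top, hn])
    ⟨u, hu, trivial⟩ (fun W _ hW => hf W hW)
  have e2 := count_out C hC.toIsCone ⊤ hw.1 hw.2 trivial
    (fun W hW _ hwW hne => h W hW hne ⟨w, hw, hwW⟩)
  have e3 : ((fun v => Submodule.span F {w} ⊔ Submodule.span F {v}) ''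
      ((C ∩ ((⊤ : Submodule F V) : Set V)) \ (Submodule.span F {w} : Submodule F V))) =
      (Submodule.comap π) '' ((fun v => (⊥ : Submodule F (Fin 2 → F)) ⊔ Submodule.span F {v}) '' D) := by
    have hc : ∀ v, Submodule.comap π (⊥ ⊔ Submodule.span F {π v}) =
        Submodule.span F {w} ⊔ Submodule.span F {v} := by
      intro v
      rw [bot_sup_eq, ← Set.image_singleton, ← Submodule.map_span, Submodule.comap_map_eq, hker,
        sup_comm]
    ext P
    constructor
    · rintro ⟨v, ⟨⟨hv, _⟩, _⟩, rfl⟩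
      exact ⟨_, ⟨π v, ⟨v, hv, rfl⟩, rfl⟩, hc v⟩
    · rintro ⟨_, ⟨_, ⟨v, hv, rfl⟩, rfl⟩, rfl⟩
      exact ⟨v, ⟨⟨hv, trivial⟩, hCM v hv⟩, (hc v).symm⟩
  rw [e3, Set.ncard_image_of_injective _ (Submodule.comap_injective_of_surjective hsurj), e1] at e2
  have key := orbit_dvd q a hq' haut D ⟨π u, u, hu, rfl⟩ (by
    rintro _ ⟨v, hv, rfl⟩ _ ⟨v', hv', rfl⟩
    have hcc := hC.toIsCone.co_co
    obtain ⟨φ, g, k1, k2, k3, k4, ⟨c, hc, k5⟩, k6⟩ :=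
      hC.co.trans' w hw v (by rwa [hcc]) w hw v' (by rwa [hcc])
    have hg0 := map_zero_of_add g k1
    have hgM : ∀ z ∈ M, π (g z) = 0 := by
      intro z hz
      obtain ⟨b, rfl⟩ := Submodule.mem_span_singleton.1 hz
      rw [hπ0, k2, k5]
      exact M.smul_mem _ (M.smul_mem _ (Submodule.mem_span_singleton_self w))
    have hgM' : ∀ z, π (g z) = 0 → z ∈ M := by
      intro z hz
      obtain ⟨b, hb⟩ := Submodule.mem_span_singleton.1 ((hπ0 _).1 hz)
      have : g z = g (φ.symm (b * c⁻¹) • w) := by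
        rw [k2, k5, RingEquiv.apply_symm_apply, smul_smul, mul_assoc, inv_mul_cancel₀ hc, mul_one, hb]
      rw [k3 this]
      exact M.smul_mem _ (Submodule.mem_span_singleton_self w)
    have hgρ : ∀ z, π (g (ρ (π z))) = π (g z) := by
      intro z
      have hm : ρ (π z) - z ∈ M := by rw [← hπ0, map_sub, hρ', sub_self]
      have := hgM _ hm
      have e : ρ (π z) = (ρ (π z) - z) + z := by abel
      rw [e, k1, map_add, this, zero_add]
    have hgC : ∀ z ∈ C, g z ∈ C := by
      intro z hz
      have hz' : z ∈ coCone (coCone C) := by rwa [hcc]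
      rw [← hcc]
      refine ⟨?_, fun hh => hz'.2 ((k4 _).1 hh)⟩
      intro h0
      exact hz'.1 (k3 (h0.trans hg0.symm))
    refine ⟨φ, fun d => π (g (ρ d)), ?_, ?_, ?_, ?_, ?_⟩
    · intro y z; simp [k1]
    · intro b y; simp [k2]
    · intro y z hyz
      have hs : π (g (ρ (y - z))) = 0 := by
        have : π (g (ρ y)) = π (g (ρ (y - z))) + π (g (ρ z)) := by
          rw [← map_add, ← k1, ← map_add, sub_add_cancel]
        simp only at hyz
        rw [hyz] at this
        simpa using this
      have := hgM' _ hs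
      rw [← hπ0, hρ', sub_eq_zero] at this
      exact this
    · rintro _ ⟨z, hz, rfl⟩
      exact ⟨g z, hgC z hz, (hgρ z).symm⟩
    · simp only [hgρ, k6])
  set N := ((fun v => (⊥ : Submodule F (Fin 2 → F)) ⊔ Submodule.span F {v}) '' D).ncard
  have hpow : q = 2 * 2 ^ (a - 1) := by
    rw [hpa, ← pow_succ']; congr 1; omega
  have hN : N = 2 ^ (a - 1) + 1 := by
    rw [mul_assoc] at e2
    have := Nat.eq_of_mul_eq_mul_left (by omega) e2
    omega
  rw [hDc, hN] at key
  have e4 : (q ^ 2 - 1) * (q ^ 2 - q) * a = (q - 1) * (a * (q ^ 2 - 1) * q) := by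
    rw [show q ^ 2 - q = (q - 1) * q by rw [Nat.sub_mul, one_mul, sq]]
    ring
  rw [e4] at key
  have key2 := Nat.dvd_of_mul_dvd_mul_left (by omega) key
  rw [hpa] at key2
  exact arith7 a ha key2

/-- the cone over a set of points. -/
def coneOf {F : Type*} [Field F] {n : ℕ} (γ : Set (Projectivization F (Fin n → F))) :
    Set (Fin n → F) := {v | ∃ hv : v ≠ 0, Projectivization.mk F v hv ∈ γ}

theorem coneOf_isCone {F : Type*} [Field F] {n : ℕ} (γ : Set (Projectivization F (Fin n → F))) :
    IsCone F (coneOf γ) where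
  zero := fun ⟨h, _⟩ => h rfl
  smul := by
    rintro c hc v ⟨hv, h⟩
    refine ⟨smul_ne_zero hc hv, ?_⟩
    convert h using 1
    rw [Projectivization.mk_eq_mk_iff']
    exact ⟨c, rfl⟩

theorem coneOf_compl {F : Type*} [Field F] {n : ℕ} (γ : Set (Projectivization F (Fin n → F))) :
    coneOf γᶜ = coCone (coneOf γ) := by
  ext v
  constructor
  · rintro ⟨hv, h⟩
    exact ⟨hv, fun ⟨_, h'⟩ => h h'⟩
  · rintro ⟨hv, h⟩
    exact ⟨hv, fun h' => h ⟨hv, h'⟩⟩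

theorem coneOf_card {F : Type*} [Field F] [Finite F] {n : ℕ}
    (γ : Set (Projectivization F (Fin n → F))) {q : ℕ} (hq : Nat.card F = q)
    (W : Submodule F (Fin n → F)) :
    (coneOf γ ∩ W).ncard = (q - 1) * (subPts W ∩ γ).ncard := by
  rw [((coneOf_isCone γ).inter W).card hq,
    ← Set.ncard_image_of_injective (subPts W ∩ γ) Projectivization.submodule_injective]
  congr 2
  ext P
  constructor
  · rintro ⟨v, ⟨⟨hv, h⟩, hW⟩, rfl⟩
    refine ⟨Projectivization.mk F v hv, ⟨⟨v, hv, hW, rfl⟩, h⟩, ?_⟩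
    simp [Projectivization.submodule_mk]
  · rintro ⟨_, ⟨⟨v, hv, hW, rfl⟩, h⟩, rfl⟩
    refine ⟨v, ⟨⟨hv, h⟩, hW⟩, ?_⟩
    simp [Projectivization.submodule_mk]

theorem subPts_top {F : Type*} [Field F] {n : ℕ} :
    subPts (⊤ : Submodule F (Fin n → F)) = Set.univ := by
  ext pt
  induction pt using Projectivization.ind with
  | h v hv => exact ⟨fun _ => trivial, fun _ => ⟨v, hv, trivial, rfl⟩⟩

theorem coneOf_nonempty {F : Type*} [Field F] {n : ℕ}
    {γ : Set (Projectivization F (Fin n → F))} (W : Submodule F (Fin n → F)) :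
    (coneOf γ ∩ W).Nonempty ↔ (subPts W ∩ γ).Nonempty := by
  constructor
  · rintro ⟨v, ⟨hv, h⟩, hW⟩
    exact ⟨_, ⟨v, hv, hW, rfl⟩, h⟩
  · rintro ⟨_, ⟨v, hv, hW, rfl⟩, h⟩
    exact ⟨v, ⟨hv, h⟩, hW⟩

theorem coneOf_sub {F : Type*} [Field F] {n : ℕ}
    {γ : Set (Projectivization F (Fin n → F))} (S : Submodule F (Fin n → F))
    (h : ∀ v, v ∈ S ↔ v = 0 ∨ v ∈ coneOf γ) : γ = subPts S := by
  ext pt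
  constructor
  · intro hpt
    induction pt using Projectivization.ind with
    | h v hv => exact ⟨v, hv, (h v).2 (Or.inr ⟨hv, hpt⟩), rfl⟩
  · rintro ⟨v, hv, hS, rfl⟩
    rcases (h v).1 hS with h0 | ⟨_, h'⟩
    · exact absurd h0 hv
    · exact h'

theorem coneOf_good {F : Type*} [Field F] {n : ℕ}
    (G : Subgroup (Equiv.Perm (Projectivization F (Fin n → F))))
    (hPGL : ∀ g ∈ G, ∃ (φ : F ≃+* F) (f : (Fin n → F) ≃ (Fin n → F)),
        (∀ x y, f (x + y) = f x + f y) ∧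
        (∀ (c : F) (x : Fin n → F), f (c • x) = φ c • f x) ∧
        ∀ (w : Fin n → F) (hw : w ≠ 0) (hfw : f w ≠ 0),
          g (Projectivization.mk F w hw) = Projectivization.mk F (f w) hfw)
    (γ : Set (Projectivization F (Fin n → F)))
    (hstr : ∀ u ∈ γ, ∀ w ∉ γ, ∀ u' ∈ γ, ∀ w' ∉ γ,
        ∃ g ∈ G, (⇑g '' γ = γ) ∧ g u = u' ∧ g w = w') : Good F (coneOf γ) where
  toIsCone := coneOf_isCone γ
  trans := by
    intro u hu w hw u' hu' w' hw'
    rw [← coneOf_compl] at hw hw'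
    obtain ⟨hu0, hu⟩ := hu
    obtain ⟨hw0, hw⟩ := hw
    obtain ⟨hu0', hu'⟩ := hu'
    obtain ⟨hw0', hw'⟩ := hw'
    obtain ⟨g, hg, hgγ, hgu, hgw⟩ := hstr _ hu _ hw _ hu' _ hw'
    obtain ⟨φ, f, f1, f2, f3⟩ := hPGL g hg
    have f0 := map_zero_of_add f f1
    have fne : ∀ v, v ≠ 0 → f v ≠ 0 := fun v hv h => hv (f.injective (h.trans f0.symm))
    have aux : ∀ (v v' : Fin n → F) (hv : v ≠ 0) (hv' : v' ≠ 0),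
        g (Projectivization.mk F v hv) = Projectivization.mk F v' hv' →
        ∃ c : F, c ≠ 0 ∧ f v = c • v' := by
      intro v v' hv hv' h
      rw [f3 v hv (fne v hv), Projectivization.mk_eq_mk_iff'] at h
      obtain ⟨c, hc⟩ := h
      refine ⟨c, ?_, hc.symm⟩
      rintro rfl
      rw [zero_smul] at hc
      exact fne v hv hc.symm
    refine ⟨φ, f, f1, f2, f.injective, ?_, aux _ _ _ _ hgu, aux _ _ _ _ hgw⟩
    intro v
    constructor
    · rintro ⟨hv, h⟩
      have hv0 : v ≠ 0 := by rintro rfl; exact hv f0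
      refine ⟨hv0, ?_⟩
      rw [← f3 v hv0 hv, ← hgγ] at h
      obtain ⟨y, hy, hyv⟩ := h
      rwa [← g.injective hyv]
    · rintro ⟨hv, h⟩
      refine ⟨fne v hv, ?_⟩
      rw [← f3 v hv (fne v hv), ← hgγ]
      exact ⟨_, h, rfl⟩

theorem class_lines {F : Type*} [Field F] [Finite F] {n : ℕ}
    (γ : Set (Projectivization F (Fin n → F))) {q x : ℕ} (hq : Nat.card F = q) (hq2 : 2 ≤ q)
    (h : IsClass F (coneOf γ) q x) (W : Submodule F (Fin n → F)) (hW : Module.finrank F W = 2) :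
    (subPts W ∩ γ).ncard = 0 ∨ (subPts W ∩ γ).ncard = x ∨ (subPts W ∩ γ).ncard = q + 1 := by
  have e1 := coneOf_card γ hq W
  rcases Set.eq_empty_or_nonempty (coneOf γ ∩ W) with h1 | h1
  · left
    rw [h1, Set.ncard_empty] at e1
    rcases Nat.mul_eq_zero.1 e1.symm with h0 | h0
    · omega
    · exact h0
  right
  rcases Set.eq_empty_or_nonempty (coCone (coneOf γ) ∩ W) with h2 | h2
  · right
    have e2 := (coneOf_isCone γ).add_card hq W
    rw [e1, h2, Set.ncard_empty, hW] at e2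
    obtain ⟨t, rfl⟩ : ∃ t, q = t + 1 := ⟨q - 1, by omega⟩
    simp only [Nat.add_sub_cancel] at e2
    apply Nat.eq_of_mul_eq_mul_left (show 0 < t by omega)
    nlinarith
  · left
    rw [h W hW h1 h2] at e1
    exact (Nat.eq_of_mul_eq_mul_left (by omega) e1).symm

theorem baer_three {F : Type*} [Field F] [Finite F] {n : ℕ} (K : Subfield F)
    (hK : ∀ s, s ∈ K ↔ s = 0 ∨ s = 1)
    (γ : Set (Projectivization F (Fin n → F)))
    (W : Submodule F (Fin n → F)) (hW : Module.finrank F W = 2)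
    (h3 : (subPts W ∩ γ).ncard = 3) :
    ∃ e f : Fin n → F, e ∈ W ∧ f ∈ W ∧ LinearIndependent F ![e, f] ∧
      subPts W ∩ γ = {pt | ∃ s t : F, s ∈ K ∧ t ∈ K ∧
        ∃ h : s • e + t • f ≠ 0, pt = Projectivization.mk F (s • e + t • f) h} := by
  obtain ⟨A, B, P, hAB, hAP, hBP, hS⟩ := Set.ncard_eq_three.1 h3
  have hA : A ∈ subPts W ∩ γ := by rw [hS]; simp
  have hB : B ∈ subPts W ∩ γ := by rw [hS]; simp
  have hP : P ∈ subPts W ∩ γ := by rw [hS]; simp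
  obtain ⟨⟨u, hu, huW, rfl⟩, -⟩ := hA
  obtain ⟨⟨w, hw, hwW, rfl⟩, -⟩ := hB
  obtain ⟨⟨z, hz, hzW, rfl⟩, -⟩ := hP
  have hwu : w ∉ Submodule.span F {u} := by
    intro hh
    obtain ⟨c, hc⟩ := Submodule.mem_span_singleton.1 hh
    exact hAB ((Projectivization.mk_eq_mk_iff' _ _ _ _ _).2 ⟨c, hc⟩).symm
  obtain ⟨α, β, hαβ⟩ := line_comb W hW huW hwW hu hwu hzW
  have hα : α ≠ 0 := by
    rintro rfl
    apply hBP
    exact ((Projectivization.mk_eq_mk_iff' _ _ _ _ _).2 ⟨β, by rw [hαβ]; simp⟩).symm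
  have hβ : β ≠ 0 := by
    rintro rfl
    apply hAP
    exact ((Projectivization.mk_eq_mk_iff' _ _ _ _ _).2 ⟨α, by rw [hαβ]; simp⟩).symm
  refine ⟨α • u, β • w, W.smul_mem _ huW, W.smul_mem _ hwW, ?_, ?_⟩
  · rw [LinearIndependent.pair_iff' (smul_ne_zero hα hu)]
    intro c hc
    apply hwu
    rw [Submodule.mem_span_singleton]
    refine ⟨β⁻¹ * (c * α), ?_⟩
    rw [← smul_smul, ← smul_smul, hc, smul_smul, inv_mul_cancel₀ hβ, one_smul]
  · rw [hS]
    ext pt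
    simp only [Set.mem_insert_iff, Set.mem_singleton_iff, Set.mem_ofPred_eq]
    constructor
    · rintro (rfl | rfl | rfl)
      · refine ⟨1, 0, (hK _).2 (by simp), (hK _).2 (by simp), by simp [hα, hu], ?_⟩
        rw [Projectivization.mk_eq_mk_iff']
        exact ⟨α⁻¹, by simp [smul_smul, hα]⟩
      · refine ⟨0, 1, (hK _).2 (by simp), (hK _).2 (by simp), by simp [hβ, hw], ?_⟩
        rw [Projectivization.mk_eq_mk_iff']
        exact ⟨β⁻¹, by simp [smul_smul, hβ]⟩
      · refine ⟨1, 1, (hK _).2 (by simp), (hK _).2 (by simp), by simpa [← hαβ] using hz, ?_⟩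
        rw [Projectivization.mk_eq_mk_iff']
        exact ⟨1, by simp [hαβ]⟩
    · rintro ⟨s, t, hs, ht, h, rfl⟩
      rcases (hK s).1 hs with rfl | rfl <;> rcases (hK t).1 ht with rfl | rfl
      · simp at h
      · right; left
        rw [Projectivization.mk_eq_mk_iff']
        exact ⟨β, by simp⟩
      · left
        rw [Projectivization.mk_eq_mk_iff']
        exact ⟨α, by simp⟩
      · right; right
        rw [Projectivization.mk_eq_mk_iff']
        exact ⟨1, by simp [hαβ]⟩

theorem exists_prime_subfield {F : Type*} [Field F] [CharP F 2] :
    ∃ K : Subfield F, Nat.card K = 2 ∧ ∀ s, s ∈ K ↔ s = 0 ∨ s = 1 := by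
  have hz : ∀ y : ZMod 2, y = 0 ∨ y = 1 := by decide
  have : Fact (Nat.Prime 2) := ⟨Nat.prime_two⟩
  let i : ZMod 2 →+* F := ZMod.castHom dvd_rfl F
  refine ⟨i.fieldRange, ?_, ?_⟩
  · have : Nat.card (Set.range i) = Nat.card (ZMod 2) :=
      Nat.card_range_of_injective i.injective
    rw [Nat.card_zmod] at this
    exact this
  · intro s
    rw [RingHom.mem_fieldRange]
    constructor
    · rintro ⟨y, rfl⟩
      rcases hz y with rfl | rfl
      · left; exact map_zero i
      · right; exact map_one i
    · rintro (rfl | rfl)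
      · exact ⟨0, map_zero i⟩
      · exact ⟨1, map_one i⟩

/-- Proposition `lem-lin2`: the higher-rank linear case, on the
point set of `PG(n-1,q)`, `n ≥ 3`. -/
theorem stmt18 {F : Type*} [Field F] [Fintype F] [DecidableEq F] (p a q n v k : ℕ)
    (hp : p.Prime) (ha : 1 ≤ a) (hq : q = p ^ a) (hn : 3 ≤ n)
    (hcard : Fintype.card F = q) (hv : (q - 1) * v = q ^ n - 1)
    (G : Subgroup (Equiv.Perm (Projectivization F (Fin n → F))))
    -- PSL(n,q) ≤ G
    (hPSL : ∀ f : (Fin n → F) ≃ₗ[F] (Fin n → F),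
        LinearMap.det (f : (Fin n → F) →ₗ[F] (Fin n → F)) = 1 →
        ∃ g ∈ G, ∀ (w : Fin n → F) (hw : w ≠ 0),
          g (Projectivization.mk F w hw) =
            Projectivization.mk F (f w) (f.map_ne_zero_iff.mpr hw))
    -- G ≤ PΓL(n,q)
    (hPGL : ∀ g ∈ G, ∃ (φ : F ≃+* F) (f : (Fin n → F) ≃ (Fin n → F)),
        (∀ x y, f (x + y) = f x + f y) ∧
        (∀ (c : F) (x : Fin n → F), f (c • x) = φ c • f x) ∧
        ∀ (w : Fin n → F) (hw : w ≠ 0) (hfw : f w ≠ 0),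
          g (Projectivization.mk F w hw) = Projectivization.mk F (f w) hfw)
    (Γ : Set (Set (Projectivization F (Fin n → F))))
    (hk3 : 3 ≤ k) (hkv : k ≤ v - 3)
    (hΓcard : ∀ γ ∈ Γ, γ.ncard = k) (hne : Γ.Nonempty)
    (hproper : Γ ≠ {s : Set (Projectivization F (Fin n → F)) | s.ncard = k})
    (hinv : ∀ g ∈ G, ∀ γ ∈ Γ, ⇑g '' γ ∈ Γ)
    -- Γ is G-strongly incidence-transitive
    (hstr₁ : ∀ γ ∈ Γ, ∀ γ' ∈ Γ, ∃ g ∈ G, ⇑g '' γ = γ')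
    (hstr₂ : ∀ γ ∈ Γ, ∀ u ∈ γ, ∀ w ∉ γ, ∀ u' ∈ γ, ∀ w' ∉ γ,
        ∃ g ∈ G, (⇑g '' γ = γ) ∧ g u = u' ∧ g w = w')
    (γ : Set (Projectivization F (Fin n → F))) (hγ : γ ∈ Γ) :
    -- either γ or its complement is the point set of a projective subspace ...
    (∃ S : Submodule F (Fin n → F), γ = subPts S ∨ γᶜ = subPts S) ∨
    -- ... or (replacing γ by its complement if necessary) γ is of class [0,x,q+1]₁
    (∃ γ' : Set (Projectivization F (Fin n → F)), (γ' = γ ∨ γ' = γᶜ) ∧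
      ∃ x : ℕ,
        (∀ W : Submodule F (Fin n → F), Module.finrank F W = 2 →
          (subPts W ∩ γ').ncard = 0 ∨ (subPts W ∩ γ').ncard = x ∨
          (subPts W ∩ γ').ncard = q + 1) ∧
        ((x = 2 ∧ (v - 1) + q ≤ q * k ∧ q * k ≤ 2 * (v - 1)) ∨
         (∃ q₀ : ℕ, q = q₀ ^ 2 ∧ x = q₀ + 1 ∧
            (v - 1) + q₀ ≤ q₀ * k ∧ q * q₀ * k ≤ q * (v - 1) + q₀ * (v - 1) ∧
            ∃ K : Subfield F, Nat.card ↥K = q₀ ∧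
              ∀ W : Submodule F (Fin n → F), Module.finrank F W = 2 →
                (subPts W ∩ γ').Nonempty → (subPts W ∩ γ'ᶜ).Nonempty →
                ∃ e f : Fin n → F, e ∈ W ∧ f ∈ W ∧ LinearIndependent F ![e, f] ∧
                  subPts W ∩ γ' = {pt | ∃ s t : F, s ∈ K ∧ t ∈ K ∧
                    ∃ h : s • e + t • f ≠ 0,
                      pt = Projectivization.mk F (s • e + t • f) h}))) := by
  have hqF : Nat.card F = q := by rw [Nat.card_eq_fintype_card, hcard]
  have hq2 : 2 ≤ q := by
    rw [← hcard]; exact Fintype.one_lt_card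
  have hC : Good F (coneOf γ) := coneOf_good G hPGL γ (hstr₂ γ hγ)
  have hfin : Module.finrank F (Fin n → F) = n := Module.finrank_fin_fun F
  have hCk : (coneOf γ ∩ ((⊤ : Submodule F (Fin n → F)) : Set (Fin n → F))).ncard = (q - 1) * k := by
    rw [coneOf_card γ hqF, subPts_top, Set.univ_inter, hΓcard γ hγ]
  have hadd := hC.toIsCone.add_card hqF ⊤
  rw [hCk, finrank_top, hfin] at hadd
  have hqn : (q - 1) * v + 1 = q ^ n := by
    have : 1 ≤ q ^ n := Nat.one_le_pow _ _ (by omega)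
    omega
  have h1 : (coneOf γ).Nonempty := by
    rw [Set.nonempty_iff_ne_empty]
    intro h0
    rw [h0, Set.empty_inter, Set.ncard_empty] at hCk
    rcases Nat.mul_eq_zero.1 hCk.symm with h | h <;> omega
  have h2 : (coCone (coneOf γ)).Nonempty := by
    rw [Set.nonempty_iff_ne_empty]
    intro h0
    rw [h0, Set.empty_inter, Set.ncard_empty] at hadd
    have : (q - 1) * k = (q - 1) * v := by omega
    have := Nat.eq_of_mul_eq_mul_left (by omega) this
    omega
  obtain ⟨x, hx1, hxq, hx⟩ := hC.exists_class hqF hq2 h1 h2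
  rcases Nat.lt_or_ge x 2 with hx2 | hx2
  · left
    obtain rfl : x = 1 := by omega
    obtain ⟨S, hS⟩ := class_one hC.toIsCone hqF hx
    exact ⟨S, Or.inl (coneOf_sub S hS)⟩
  rcases Nat.lt_or_ge x q with hxq' | hxq'
  swap
  · left
    obtain rfl : x = q := by omega
    have hco := hx.co hC.toIsCone hqF hq2 le_rfl
    rw [show x + 1 - x = 1 by omega] at hco
    obtain ⟨S, hS⟩ := class_one hC.toIsCone.co hqF hco
    rw [← coneOf_compl] at hS
    exact ⟨S, Or.inr (coneOf_sub S hS)⟩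
  right
  refine ⟨γ, Or.inl rfl, x, class_lines γ hqF hq2 hx, ?_⟩
  rcases arc_dich hC.toIsCone hp hq hqF hq2 hx2 hxq' hx (by omega) h1 h2 with ⟨hd, hf⟩ | ⟨hd, hf⟩
  · left
    obtain rfl := x_eq_two hC hp hq hqF hq2 hx2 hxq' hx h1 h2 hd
    obtain ⟨u, hu⟩ := h1
    obtain ⟨N, hN1, hN2⟩ := count_in hqF hq2 le_rfl (coneOf γ) hC.toIsCone ⊤ hu trivial
      (fun W hW _ huW => hx W hW ⟨u, hu, huW⟩ (hf W hW))
    rw [finrank_top, hfin, ← hqn] at hN1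
    rw [hCk] at hN2
    obtain ⟨t, rfl⟩ : ∃ t, q = t + 1 := ⟨q - 1, by omega⟩
    have ht : 0 < t := by omega
    simp only [Nat.add_sub_cancel] at hN1 hN2
    have hk : k = 1 + N := by
      apply Nat.eq_of_mul_eq_mul_left ht
      rw [hN2]; ring
    have hvN : v = 1 + (t + 1) * N := by
      apply Nat.eq_of_mul_eq_mul_left ht
      rw [show (t + 1) ^ 2 - (t + 1) = (t + 1) * t by
        rw [show (t + 1) ^ 2 = (t + 1) * t + (t + 1) by ring]; omega] at hN1
      nlinarith
    have hN : 1 ≤ N := by omega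
    subst hk hvN
    rw [Nat.add_sub_cancel_left]
    refine ⟨rfl, ?_, ?_⟩ <;> nlinarith
  · right
    have hcc := hC.toIsCone.co_co
    have hco := hx.co hC.toIsCone hqF hq2 hxq
    have hxe : q + 1 - x = 2 := x_eq_two hC.co hp hq hqF hq2 (by omega) (by omega) hco h2
      (by rwa [hcc]) hd
    rw [hxe] at hco hd
    have hp2 : p = 2 := by
      rw [hq] at hd
      exact ((Nat.prime_dvd_prime_iff_eq Nat.prime_two hp).1 (Nat.prime_two.dvd_of_dvd_pow hd)).symm
    subst hp2
    have hf' : ∀ W : Submodule F (Fin n → F), Module.finrank F W = 2 →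
        (coCone (coCone (coneOf γ)) ∩ W).Nonempty := by rwa [hcc]
    have h1' : (coCone (coCone (coneOf γ))).Nonempty := by rwa [hcc]
    have hn3 : n = 3 := by
      by_contra hne
      exact no_dim4 hC.toIsCone.co hqF (by omega) hco hf' (by omega) h2 h1'
    subst hn3
    have ha2 : a = 2 := by
      have : ¬ 3 ≤ a := fun ha3 => no_big hC.co hq ha3 hqF hco hf' hfin h2 h1'
      by_contra hne
      have : a = 1 := by omega
      subst this
      omega
    subst ha2
    obtain rfl : q = 4 := by rw [hq]; norm_num
    obtain rfl : x = 3 := by omega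
    have hcard' := plane_card hC.toIsCone.co hqF hq2 le_rfl hco ⊤ (by rw [finrank_top, hfin])
      (by obtain ⟨w, hw⟩ := h2; exact ⟨w, hw, trivial⟩) (fun W _ hW => hf' W hW)
    rw [hcard'] at hadd
    have hk : k = 15 := by omega
    have hv' : v = 21 := by omega
    have hchar : CharP F 2 := by
      have : Fact (Nat.Prime 2) := ⟨Nat.prime_two⟩
      exact charP_of_card_eq_prime_pow (f := 2) (by rw [hcard]; norm_num)
    obtain ⟨K, hK1, hK2⟩ := exists_prime_subfield (F := F)
    refine ⟨2, by norm_num, rfl, by omega, by omega, K, hK1, ?_⟩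
    intro W hW hn1 hn2
    apply baer_three K hK2 γ W hW
    have e1 := coneOf_card γ hqF W
    rw [hx W hW ((coneOf_nonempty W).2 hn1)
      (by rw [← coneOf_compl]; exact (coneOf_nonempty W).2 hn2)] at e1
    omega
end

section
/- Let q be a prime power, F = F_{q²}, V = F³, and φ : V × V → F the Hermitian form φ(x,y) = x₁·y₃^q + x₃·y₁^q + x₂·y₂^q. Let 𝒱 be the set of isotropic 1-dimensional subspaces of V, and let G be the group of permutations of 𝒱 induced by GU(3,q) = { g ∈ GL(V) : φ(g x, g y) = φ(x,y) for all x, y ∈ V }. Then: every nondegenerate 2-dimensional subspace L of V contains exactly q+1 elements of 𝒱, giving a (q+1)-subset γ_L of 𝒱; the classical unital Γ = { γ_L : L a nondegenerate 2-dimensional subspace of V } is G-strongly incidence-transitive, i.e. G is transitive on Γ and, for each γ ∈ Γ, the setwise stabiliser G_γ is transitive on γ × (𝒱 ∖ γ); any two distinct points of 𝒱 lie in exactly one member of Γ, so any two distinct members of Γ intersect in at most one point; and the minimum distance of Γ is δ(Γ) = q. -/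
/-- The map induced on projective points by an invertible linear map. -/
noncomputable def pmap {F : Type*} [Field F] {n : ℕ}
    (f : (Fin n → F) ≃ₗ[F] (Fin n → F)) :
    Projectivization F (Fin n → F) → Projectivization F (Fin n → F) :=
  fun pt => Projectivization.mk F (f pt.rep) (f.map_ne_zero_iff.mpr pt.rep_nonzero)

namespace Unital

variable {F : Type*} [Field F]

/-- The field-theoretic facts that are used. -/
structure Good (F : Type*) [Field F] (q : ℕ) : Prop where
  pos : q ≠ 0
  add : ∀ a b : F, (a + b) ^ q = a ^ q + b ^ q
  conj : ∀ a : F, (a ^ q) ^ q = a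
  trace : ∀ a : F, a ^ q = a → ∃ s : F, s + s ^ q = a
  norm : ∀ a : F, a ^ q = a → ∃ s : F, s * s ^ q = a
  ker : {t : F | t + t ^ q = 0}.ncard = q

theorem good [Fintype F] [DecidableEq F] (q : ℕ)
    (hqpp : ∃ (p m : ℕ), p.Prime ∧ 1 ≤ m ∧ q = p ^ m)
    (hcard : Fintype.card F = q ^ 2) : Good F q := by
  obtain ⟨p, m, hp, hm, rfl⟩ := hqpp
  have : Fact p.Prime := ⟨hp⟩
  have hq1 : 1 < p ^ m := Nat.one_lt_pow (by omega) hp.one_lt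
  set q := p ^ m with hqd
  have hchar : CharP F p := by
    have h1 : CharP F (ringChar F) := ringChar.charP F
    have h2 := FiniteField.card' F
    obtain ⟨p', h3, n, h4, h5⟩ := h2
    have h6 : p' ∣ q ^ 2 := by
      rw [← hcard, h5]; exact dvd_pow_self _ n.ne_zero
    have h7 : p' ∣ p := h4.dvd_of_dvd_pow (h4.dvd_of_dvd_pow h6)
    rw [(Nat.prime_dvd_prime_iff_eq h4 hp).mp h7] at h3
    exact h3
  have hadd : ∀ a b : F, (a + b) ^ q = a ^ q + b ^ q := fun a b => add_pow_char_pow a b p m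
  have hconj : ∀ a : F, (a ^ q) ^ q = a := fun a => by
    rw [← pow_mul, ← sq, ← hcard, FiniteField.pow_card]
  -- the trace map
  let T : F →+ F :=
    { toFun := fun t => t + t ^ q
      map_zero' := by rw [zero_pow (by omega), add_zero]
      map_add' := fun a b => by simp only [hadd]; ring }
  have hker : {t : F | t + t ^ q = 0} = (T.ker : Set F) := by
    ext t; simp [T, AddMonoidHom.mem_ker]
  have hroots : ∀ P : Polynomial F, P.natDegree = q → P ≠ 0 → ∀ S : Set F,
      (∀ x ∈ S, P.IsRoot x) → S.ncard ≤ q := by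
    intro P hP h0 S hS
    have h1 : S ⊆ (P.roots.toFinset : Set F) := by
      intro x hx
      simp [h0]; exact hS x hx
    calc S.ncard ≤ (P.roots.toFinset : Set F).ncard := Set.ncard_le_ncard h1 (Finset.finite_toSet _)
      _ = P.roots.toFinset.card := Set.ncard_coe_finset _
      _ ≤ P.roots.card := Multiset.toFinset_card_le _
      _ ≤ P.natDegree := Polynomial.card_roots' _
      _ = q := hP
  have hdeg : ∀ c : F, (Polynomial.X ^ q + Polynomial.C c * Polynomial.X : Polynomial F).natDegree = q := by
    intro c
    rw [Polynomial.natDegree_add_eq_left_of_natDegree_lt]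
    · simp
    · simp only [Polynomial.natDegree_X_pow]
      exact lt_of_le_of_lt ((Polynomial.natDegree_C_mul_le c _).trans Polynomial.natDegree_X_le) hq1
  have hne : ∀ c : F, (Polynomial.X ^ q + Polynomial.C c * Polynomial.X : Polynomial F) ≠ 0 := by
    intro c h
    have := hdeg c
    rw [h] at this
    simp at this; omega
  have k1 : {t : F | t + t ^ q = 0}.ncard ≤ q := by
    refine hroots _ (hdeg 1) (hne 1) _ ?_
    intro x hx
    have hx : x + x ^ q = 0 := hx
    simp [Polynomial.IsRoot]; rw [add_comm]; exact hx
  have k2 : {t : F | t ^ q = t}.ncard ≤ q := by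
    refine hroots _ (hdeg (-1)) (hne (-1)) _ ?_
    intro x hx
    have hx : x ^ q = x := hx
    simp [Polynomial.IsRoot, hx]
  have k3 : (T.range : Set F) ⊆ {t : F | t ^ q = t} := by
    rintro _ ⟨s, rfl⟩
    show (s + s ^ q) ^ q = s + s ^ q
    rw [hadd, hconj, add_comm]
  have k4 : (T.range : Set F).ncard * (T.ker : Set F).ncard = q * q := by
    have h := T.ker.card_mul_index
    rw [AddSubgroup.index_ker, Nat.card_eq_fintype_card (α := F), hcard] at h
    rw [← Nat.card_coe_set_eq, ← Nat.card_coe_set_eq, mul_comm, ← sq]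
    exact h
  have k5 : (T.range : Set F).ncard ≤ q := (Set.ncard_le_ncard k3 (Set.toFinite _)).trans k2
  have k6 : (T.ker : Set F).ncard = q := by
    rw [hker] at k1
    nlinarith
  have k7 : (T.range : Set F).ncard = q := by
    rw [k6] at k4
    exact Nat.eq_of_mul_eq_mul_right (by omega) k4
  have k8 : (T.range : Set F) = {t : F | t ^ q = t} :=
    Set.eq_of_subset_of_ncard_le k3 (by rw [k7]; exact k2) (Set.toFinite _)
  refine ⟨by omega, hadd, hconj, ?_, ?_, by rw [hker]; exact k6⟩
  · intro a ha
    have : a ∈ (T.range : Set F) := by rw [k8]; exact ha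
    exact this
  · intro a ha
    by_cases h0 : a = 0
    · exact ⟨0, by simp [h0]⟩
    obtain ⟨g, hg⟩ := IsCyclic.exists_generator (α := Fˣ)
    obtain ⟨k, hk⟩ := Subgroup.mem_zpowers_iff.mp (hg (Units.mk0 a h0))
    have ho : orderOf g = q ^ 2 - 1 := by
      rw [orderOf_eq_card_of_forall_mem_zpowers hg, Nat.card_eq_fintype_card, Fintype.card_units, hcard]
    have h1 : g ^ (k * ((q : ℤ) - 1)) = 1 := by
      rw [zpow_mul, hk, zpow_sub, zpow_one, zpow_natCast, mul_inv_eq_one]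
      ext; simpa using ha
    have h2 : ((q ^ 2 - 1 : ℕ) : ℤ) ∣ k * ((q : ℤ) - 1) := by
      rw [← ho]; exact orderOf_dvd_iff_zpow_eq_one.mpr h1
    have h3 : ((q ^ 2 - 1 : ℕ) : ℤ) = ((q : ℤ) + 1) * ((q : ℤ) - 1) := by
      rw [Nat.cast_sub (Nat.one_le_pow _ _ (by omega))]; push_cast; ring
    rw [h3] at h2
    obtain ⟨j, hj⟩ := Int.dvd_of_mul_dvd_mul_right (by omega) h2
    refine ⟨((g ^ j : Fˣ) : F), ?_⟩
    have h4 : (g ^ j) * (g ^ j) ^ q = Units.mk0 a h0 := by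
      rw [← hk, hj, ← zpow_natCast, ← zpow_mul, ← zpow_add]
      congr 1; ring
    have := congrArg Units.val h4
    simpa using this

/-- the form -/
def hf (q : ℕ) (x y : Fin 3 → F) : F := x 0 * (y 2) ^ q + x 2 * (y 0) ^ q + x 1 * (y 1) ^ q

variable {q : ℕ}

theorem hf_add_left (x y z : Fin 3 → F) : hf q (x + y) z = hf q x z + hf q y z := by
  simp [hf]; ring
theorem hf_smul_left (c : F) (x z : Fin 3 → F) : hf q (c • x) z = c * hf q x z := by
  simp [hf]; ring
theorem hf_add_right (h : Good F q) (x y z : Fin 3 → F) : hf q x (y + z) = hf q x y + hf q x z := by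
  simp [hf, h.add]; ring
theorem hf_smul_right (c : F) (x z : Fin 3 → F) : hf q x (c • z) = c ^ q * hf q x z := by
  simp [hf, mul_pow]; ring
theorem hf_symm (h : Good F q) (x y : Fin 3 → F) : hf q x y = (hf q y x) ^ q := by
  simp [hf, h.add, mul_pow, h.conj]; ring
theorem hf_symm0 (h : Good F q) {x y : Fin 3 → F} (h0 : hf q x y = 0) : hf q y x = 0 := by
  rw [hf_symm h, h0, zero_pow h.pos]
theorem hf_symm1 (h : Good F q) {x y : Fin 3 → F} (h0 : hf q x y = 1) : hf q y x = 1 := by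
  rw [hf_symm h, h0, one_pow]
theorem hf_zero_left (x : Fin 3 → F) : hf q 0 x = 0 := by simp [hf]

/-- orthogonal isotropic vectors are proportional -/
theorem prop_of_orth (h : Good F q) {u v : Fin 3 → F} (hu0 : u ≠ 0) (hu : hf q u u = 0)
    (hv : hf q v v = 0) (huv : hf q u v = 0) : ∃ c : F, v = c • u := by
  have key : ∀ x : Fin 3 → F, hf q x x = 0 → x 2 = 0 → x 1 = 0 := by
    intro x hx h2
    simp [hf, h2, h.pos] at hx
    tauto
  have hvu := hf_symm0 h huv
  by_cases h2 : u 2 = 0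
  · have h1 := key u hu h2
    have h0 : u 0 ≠ 0 := by
      intro h0; apply hu0; ext i; fin_cases i <;> simp [h0, h1, h2]
    have v2 : v 2 = 0 := by
      simp [hf, h1, h2, h0, h.pos] at huv; exact huv
    have v1 := key v hv v2
    refine ⟨v 0 / u 0, ?_⟩
    ext i; fin_cases i <;> simp [h0, h1, h2, v1, v2]
  · refine ⟨v 2 / u 2, ?_⟩
    set c := v 2 / u 2 with hc
    set w := v + (-c) • u with hw
    have w2 : w 2 = 0 := by simp [hw, hc, h2]
    have ww : hf q w w = 0 := by
      simp [hw, hf_add_left, hf_add_right h, hf_smul_left, hf_smul_right, hu, hv, huv, hvu, -neg_smul]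
    have w1 := key w ww w2
    have uw : hf q u w = 0 := by
      simp [hw, hf_add_right h, hf_smul_right, hu, huv, -neg_smul]
    have w0 : w 0 = 0 := by
      simp [hf, w1, w2, h2, h.pos] at uw; exact uw
    have : w = 0 := by ext i; fin_cases i <;> simp [w0, w1, w2]
    rw [hw] at this
    simpa [add_neg_eq_zero] using this

/-- nondegenerate planes -/
def Nd (q : ℕ) (L : Submodule F (Fin 3 → F)) : Prop :=
  Module.finrank F L = 2 ∧ ∀ u ∈ L, u ≠ 0 → ∃ w ∈ L, hf q u w ≠ 0

theorem indep_of_gram {u v : Fin 3 → F} (h : Good F q) (hu : hf q u u = 0) (huv : hf q u v = 1) :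
    LinearIndependent F ![u, v] := by
  rw [LinearIndependent.pair_iff]
  intro s t hst
  have h1 : hf q (s • u + t • v) u = 0 := by rw [hst, hf_zero_left]
  have h2 : hf q (s • u + t • v) v = 0 := by rw [hst, hf_zero_left]
  simp only [hf_add_left, hf_smul_left, hu, huv, hf_symm1 h huv] at h1 h2
  have : t = 0 := by simpa using h1
  subst this
  exact ⟨by simpa using h2, rfl⟩

theorem span_of_indep {L : Submodule F (Fin 3 → F)} (hL : Module.finrank F L = 2) {u v : Fin 3 → F}
    (hu : u ∈ L) (hv : v ∈ L) (hi : LinearIndependent F ![u, v]) :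
    L = Submodule.span F {u, v} := by
  symm
  apply Submodule.eq_of_le_of_finrank_eq
  · rw [Submodule.span_le]; rintro x (rfl | rfl) <;> assumption
  · rw [hL]
    have := finrank_span_eq_card hi
    rw [← Matrix.range_cons_cons_empty u v ![], this]; rfl

theorem exists_iso (h : Good F q) {L : Submodule F (Fin 3 → F)} (hL : Nd q L) :
    ∃ u ∈ L, u ≠ 0 ∧ hf q u u = 0 := by
  obtain ⟨hd, hn⟩ := hL
  by_contra! hcon
  obtain ⟨u, hu, hu0⟩ : ∃ u ∈ L, u ≠ 0 := by
    apply Submodule.exists_mem_ne_zero_of_ne_bot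
    rintro rfl; simp at hd
  obtain ⟨w, hw, hwu⟩ : ∃ w ∈ L, w ∉ Submodule.span F {u} := by
    by_contra! hc
    have := Submodule.finrank_mono (show L ≤ Submodule.span F {u} from hc)
    rw [finrank_span_singleton hu0] at this
    omega
  have ha := hcon u hu hu0
  set v := w + (-(hf q w u / hf q u u)) • u with hv
  have hvL : v ∈ L := L.add_mem hw (L.smul_mem _ hu)
  have hv0 : v ≠ 0 := by
    intro h0
    apply hwu
    rw [Submodule.mem_span_singleton]
    refine ⟨hf q w u / hf q u u, ?_⟩
    rw [hv] at h0
    rw [neg_smul, add_neg_eq_zero] at h0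
    exact h0.symm
  have hvu : hf q v u = 0 := by
    rw [hv, hf_add_left, hf_smul_left]; field_simp; ring
  have huv := hf_symm0 h hvu
  have hb := hcon v hvL hv0
  obtain ⟨t, ht⟩ := h.norm (-(hf q u u / hf q v v)) (by
    have e : ∀ c : F, (-c) ^ q = - c ^ q := by
      intro c
      have := h.add c (-c)
      rw [add_neg_cancel, zero_pow h.pos] at this
      exact eq_neg_of_add_eq_zero_right this.symm
    rw [e, div_pow, ← hf_symm h, ← hf_symm h])
  have ht0 : hf q (u + t • v) (u + t • v) = 0 := by
    simp only [hf_add_left, hf_add_right h, hf_smul_left, hf_smul_right, huv, hvu]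
    have : t * (t ^ q * hf q v v) = - hf q u u := by
      rw [← mul_assoc, ht]; field_simp
    linear_combination this
  refine hcon (u + t • v) (L.add_mem hu (L.smul_mem _ hvL)) ?_ ht0
  intro h0
  have h1 : hf q (u + t • v) u = 0 := by rw [h0, hf_zero_left]
  rw [hf_add_left, hf_smul_left, hvu] at h1
  apply ha; simpa using h1

theorem exists_pair (h : Good F q) {L : Submodule F (Fin 3 → F)} (hL : Nd q L)
    {u : Fin 3 → F} (huL : u ∈ L) (hu0 : u ≠ 0) (hu : hf q u u = 0) :
    ∃ v ∈ L, hf q v v = 0 ∧ hf q u v = 1 ∧ L = Submodule.span F {u, v} := by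
  obtain ⟨hd, hn⟩ := hL
  obtain ⟨w, hw, hc⟩ := hn u huL hu0
  set w' := (hf q w u)⁻¹ • w with hw'
  have hc' : hf q w u ≠ 0 := fun h0 => hc (hf_symm0 h h0)
  have h1 : hf q w' u = 1 := by rw [hw', hf_smul_left]; field_simp
  have h2 := hf_symm1 h h1
  have e : ∀ c : F, (-c) ^ q = - c ^ q := by
    intro c
    have := h.add c (-c)
    rw [add_neg_cancel, zero_pow h.pos] at this
    exact eq_neg_of_add_eq_zero_right this.symm
  obtain ⟨s, hs⟩ := h.trace (-(hf q w' w')) (by rw [e, ← hf_symm h])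
  have hm : w' + s • u ∈ L := L.add_mem (L.smul_mem _ hw) (L.smul_mem _ huL)
  have h3 : hf q u (w' + s • u) = 1 := by
    rw [hf_add_right h, hf_smul_right s, hu, h2]; ring
  refine ⟨w' + s • u, hm, ?_, h3, span_of_indep hd huL hm (indep_of_gram h hu h3)⟩
  simp only [hf_add_left, hf_add_right h, hf_smul_left, hf_smul_right, hu, h1, h2]
  linear_combination hs

theorem span_nd (h : Good F q) {u v : Fin 3 → F} (hu : hf q u u = 0) (hv : hf q v v = 0)
    (huv : hf q u v ≠ 0) : Nd q (Submodule.span F {u, v}) := by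
  have hvu : hf q v u ≠ 0 := fun h0 => huv (hf_symm0 h h0)
  constructor
  · have hi : LinearIndependent F ![u, v] := by
      rw [LinearIndependent.pair_iff]
      intro s t hst
      have h1 : hf q (s • u + t • v) u = 0 := by rw [hst, hf_zero_left]
      have h2 : hf q (s • u + t • v) v = 0 := by rw [hst, hf_zero_left]
      simp only [hf_add_left, hf_smul_left, hu, hv] at h1 h2
      simp_all
    rw [← Matrix.range_cons_cons_empty u v ![], finrank_span_eq_card hi]; rfl
  · intro x hx hx0
    obtain ⟨a, b, rfl⟩ := Submodule.mem_span_pair.mp hx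
    by_cases ha : a = 0
    · refine ⟨u, Submodule.subset_span (by simp), ?_⟩
      have hb : b ≠ 0 := by rintro rfl; simp [ha] at hx0
      simp [hf_add_left, hf_smul_left, hu, hvu, hb]
    · refine ⟨v, Submodule.subset_span (by simp), ?_⟩
      simp [hf_add_left, hf_smul_left, hv, huv, ha]

theorem exists_normal (h : Good F q) {L : Submodule F (Fin 3 → F)} {u v : Fin 3 → F}
    (hu : hf q u u = 0) (hv : hf q v v = 0) (huv : hf q u v = 1) (hL : Nd q L)
    (hs : L = Submodule.span F {u, v}) :
    ∃ n, hf q n n = 1 ∧ hf q n u = 0 ∧ hf q n v = 0 ∧ ∀ x, x ∈ L ↔ hf q x n = 0 := by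
  have hvu := hf_symm1 h huv
  obtain ⟨x, -, hx⟩ : ∃ x ∈ (⊤ : Submodule F (Fin 3 → F)), x ∉ L := by
    by_contra! hc
    have := Submodule.finrank_mono (show ⊤ ≤ L from hc)
    rw [finrank_top, hL.1] at this
    simp at this
  set P : (Fin 3 → F) → (Fin 3 → F) := fun x => hf q x v • u + hf q x u • v with hP
  have hPL : ∀ x, P x ∈ L := by
    intro x; rw [hs]; exact Submodule.mem_span_pair.mpr ⟨_, _, rfl⟩
  set y := x + (-1 : F) • P x with hy
  have hyu : hf q y u = 0 := by
    simp only [hy, hP, hf_add_left, hf_smul_left, hu, hvu]; ring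
  have hyv : hf q y v = 0 := by
    simp only [hy, hP, hf_add_left, hf_smul_left, hv, huv]; ring
  have hy0 : y ≠ 0 := by
    intro h0
    apply hx
    have : x = P x := by
      have : x + (-1 : F) • P x = 0 := h0
      rwa [neg_smul, one_smul, add_neg_eq_zero] at this
    rw [this]; exact hPL x
  have hyy : hf q y y ≠ 0 := by
    intro h0
    have hu0 : u ≠ 0 := by rintro rfl; simp [hf_zero_left] at huv
    obtain ⟨c, hc⟩ := prop_of_orth h hu0 hu h0 (hf_symm0 h hyu)
    rw [hc, hf_smul_left, huv, mul_one] at hyv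
    apply hy0; rw [hc, hyv, zero_smul]
  obtain ⟨s, hs'⟩ := h.norm (hf q y y)⁻¹ (by rw [inv_pow, ← hf_symm h])
  have hn : hf q (s • y) (s • y) = 1 := by
    rw [hf_smul_left, hf_smul_right, ← mul_assoc, hs']; field_simp
  have hnu : hf q (s • y) u = 0 := by rw [hf_smul_left, hyu, mul_zero]
  have hnv : hf q (s • y) v = 0 := by rw [hf_smul_left, hyv, mul_zero]
  refine ⟨s • y, hn, hnu, hnv, ?_⟩
  intro z
  constructor
  · intro hz
    rw [hs] at hz
    obtain ⟨a, b, rfl⟩ := Submodule.mem_span_pair.mp hz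
    rw [hf_add_left, hf_smul_left a, hf_smul_left b, hf_symm0 h hnu, hf_symm0 h hnv]; ring
  · intro hz
    by_contra hzL
    -- z - P z is orthogonal to u, v, n, and hence isotropic
    have hd : L ⊔ Submodule.span F {s • y} = ⊤ := by
      have hyL : s • y ∉ L := by
        intro hyL
        have hz := hyL
        rw [hs] at hz
        obtain ⟨a, b, hab⟩ := Submodule.mem_span_pair.mp hz
        have h1 := hn
        conv at h1 => 
          lhs
          arg 2
          rw [← hab]
        rw [hf_add_left, hf_smul_left a, hf_smul_left b, hf_symm0 h hnu, hf_symm0 h hnv] at h1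
        simp at h1
      have hlt : L < L ⊔ Submodule.span F {s • y} := by
        refine lt_of_le_of_ne le_sup_left ?_
        intro he
        apply hyL; rw [he]
        exact Submodule.mem_sup_right (Submodule.mem_span_singleton_self _)
      have := Submodule.finrank_lt_finrank_of_lt hlt
      apply Submodule.eq_top_of_finrank_eq
      have h3 := Submodule.finrank_le (L ⊔ Submodule.span F {s • y})
      rw [hL.1] at this
      simp at h3 ⊢
      omega
    have hzt : z ∈ L ⊔ Submodule.span F {s • y} := by rw [hd]; trivial
    obtain ⟨l, hl, m, hm, rfl⟩ := Submodule.mem_sup.mp hzt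
    obtain ⟨c, rfl⟩ := Submodule.mem_span_singleton.mp hm
    have hl2 := hl
    rw [hs] at hl2
    obtain ⟨a, b, rfl⟩ := Submodule.mem_span_pair.mp hl2
    rw [hf_add_left, hf_add_left, hf_smul_left a, hf_smul_left b, hf_smul_left c, hn,
      hf_symm0 h hnu, hf_symm0 h hnv] at hz
    have : c = 0 := by simpa using hz
    subst this
    apply hzL; simpa using hl

/-- The frame attached to a flag. -/
structure Frame (q : ℕ) (n u l : Fin 3 → F) : Prop where
  nn : hf q n n = 1
  nu : hf q n u = 0
  nl : hf q n l = 0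
  uu : hf q u u = 0
  ul : hf q u l = 1
  ll : hf q l l = -1

theorem Frame.indep (h : Good F q) {n u l : Fin 3 → F} (fr : Frame q n u l) :
    LinearIndependent F ![n, u, l] := by
  rw [Fintype.linearIndependent_iff]
  intro g hg
  simp only [Fin.sum_univ_three, Matrix.cons_val_zero, Matrix.cons_val_one, Matrix.cons_val] at hg
  have e : ∀ y, hf q (g 0 • n + g 1 • u + g 2 • l) y = 0 := fun y => by rw [hg, hf_zero_left]
  have e1 := e n
  have e2 := e u
  have e3 := e l
  simp only [hf_add_left, hf_smul_left, fr.nn, fr.nu, fr.nl, fr.uu, fr.ul, fr.ll,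
    hf_symm0 h fr.nu, hf_symm0 h fr.nl, hf_symm1 h fr.ul] at e1 e2 e3
  have g0 : g 0 = 0 := by simpa using e1
  have g2 : g 2 = 0 := by simpa using e2
  have g1 : g 1 = 0 := by simpa [g0, g2] using e3
  intro i; fin_cases i <;> assumption

theorem Frame.map (h : Good F q) {n u l n' u' l' : Fin 3 → F} (fr : Frame q n u l)
    (fr' : Frame q n' u' l') : ∃ f : (Fin 3 → F) ≃ₗ[F] (Fin 3 → F),
      (∀ x y, hf q (f x) (f y) = hf q x y) ∧ f n = n' ∧ f u = u' ∧ f l = l' := by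
  let B := basisOfLinearIndependentOfCardEqFinrank (fr.indep h) (by simp)
  let B' := basisOfLinearIndependentOfCardEqFinrank (fr'.indep h) (by simp)
  let f := B.equiv B' (Equiv.refl _)
  have fB : ∀ i, f (![n, u, l] i) = ![n', u', l'] i := by
    intro i
    have := B.equiv_apply i B' (Equiv.refl _)
    simpa [B, B', f] using this
  have fn : f n = n' := fB 0
  have fu : f u = u' := fB 1
  have fl : f l = l' := fB 2
  refine ⟨f, ?_, fn, fu, fl⟩
  have rep : ∀ x, ∃ a b c : F, x = a • n + b • u + c • l := by
    intro x
    have := B.sum_repr x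
    rw [Fin.sum_univ_three] at this
    simp [B] at this
    exact ⟨_, _, _, this.symm⟩
  intro x y
  obtain ⟨a, b, c, rfl⟩ := rep x
  obtain ⟨a', b', c', rfl⟩ := rep y
  simp only [map_add, map_smul, fn, fu, fl, hf_add_left, hf_smul_left, hf_add_right h, hf_smul_right,
    fr.nn, fr.nu, fr.nl, fr.uu, fr.ul, fr.ll,
    hf_symm0 h fr.nu, hf_symm0 h fr.nl, hf_symm1 h fr.ul,
    fr'.nn, fr'.nu, fr'.nl, fr'.uu, fr'.ul, fr'.ll,
    hf_symm0 h fr'.nu, hf_symm0 h fr'.nl, hf_symm1 h fr'.ul]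

theorem exists_frame (h : Good F q) {L : Submodule F (Fin 3 → F)} (hL : Nd q L)
    {u w : Fin 3 → F} (huL : u ∈ L) (hu0 : u ≠ 0) (hu : hf q u u = 0)
    (hwL : w ∉ L) (hw : hf q w w = 0) :
    ∃ n l : Fin 3 → F, ∃ a b : F, a ≠ 0 ∧ b ≠ 0 ∧ Frame q n (a • u) l ∧ n + l = b • w ∧
      ∀ x, x ∈ L ↔ hf q x n = 0 := by
  obtain ⟨v, hvL, hv, huv, hs⟩ := exists_pair h hL huL hu0 hu
  obtain ⟨n, hn, hnu, hnv, hLn⟩ := exists_normal h hu hv huv hL hs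
  have hwn : hf q w n ≠ 0 := fun h0 => hwL ((hLn w).mpr h0)
  set b := (hf q w n)⁻¹ with hb
  set l := b • w + (-1 : F) • n with hl
  have hln : hf q l n = 0 := by
    rw [hl, hf_add_left, hf_smul_left, hf_smul_left, hn, hb]; field_simp; ring
  have hnl := hf_symm0 h hln
  have hw' : n + l = b • w := by rw [hl]; simp
  have hll : hf q l l = -1 := by
    have : hf q (n + l) (n + l) = 0 := by rw [hw', hf_smul_left, hf_smul_right, hw]; ring
    simp only [hf_add_left, hf_add_right h, hn, hln, hnl] at this
    linear_combination this
  have hul : hf q u l ≠ 0 := by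
    intro h0
    have h1 := hf_symm0 h h0
    have hlL := (hLn l).mpr hln
    rw [hs] at hlL
    obtain ⟨c, d, hcd⟩ := Submodule.mem_span_pair.mp hlL
    rw [← hcd, hf_add_left, hf_smul_left, hf_smul_left, hu, hf_symm1 h huv] at h1
    have : d = 0 := by simpa using h1
    rw [← hcd, this, zero_smul, add_zero, hf_smul_left, hf_smul_right, hu] at hll
    simp at hll
  refine ⟨n, l, (hf q u l)⁻¹, b, inv_ne_zero hul, inv_ne_zero hwn, ⟨hn, ?_, hnl, ?_, ?_, hll⟩, hw', hLn⟩
  · rw [hf_smul_right, hnu, mul_zero]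
  · rw [hf_smul_left, hf_smul_right, hu]; ring
  · rw [hf_smul_left]; field_simp

open Projectivization

/-- codeword -/
def cw (q : ℕ) (L : Submodule F (Fin 3 → F)) : Set (Projectivization F (Fin 3 → F)) :=
  {pt | hf q pt.rep pt.rep = 0 ∧ pt.rep ∈ L}

theorem iso_mk {x : Fin 3 → F} (hx : x ≠ 0) :
    hf q (mk F x hx).rep (mk F x hx).rep = 0 ↔ hf q x x = 0 := by
  obtain ⟨a, ha⟩ := exists_smul_eq_mk_rep F x hx
  rw [← ha]
  simp [Units.smul_def, hf_smul_left, hf_smul_right]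

theorem mem_mk (L : Submodule F (Fin 3 → F)) {x : Fin 3 → F} (hx : x ≠ 0) :
    (mk F x hx).rep ∈ L ↔ x ∈ L := by
  obtain ⟨a, ha⟩ := exists_smul_eq_mk_rep F x hx
  rw [← ha]
  simp [Units.smul_def]

theorem mk_mem_cw (L : Submodule F (Fin 3 → F)) {x : Fin 3 → F} (hx : x ≠ 0) :
    mk F x hx ∈ cw q L ↔ hf q x x = 0 ∧ x ∈ L := by
  show _ ∧ _ ↔ _
  rw [iso_mk, mem_mk]

theorem pmap_mk (f : (Fin 3 → F) ≃ₗ[F] (Fin 3 → F)) {x : Fin 3 → F} (hx : x ≠ 0) :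
    pmap f (mk F x hx) = mk F (f x) (f.map_ne_zero_iff.mpr hx) := by
  obtain ⟨a, ha⟩ := exists_smul_eq_mk_rep F x hx
  unfold pmap
  rw [mk_eq_mk_iff']
  refine ⟨a, ?_⟩
  rw [← ha]; simp [Units.smul_def]

theorem image_cw {L L' : Submodule F (Fin 3 → F)} {n n' : Fin 3 → F}
    (hL : ∀ x, x ∈ L ↔ hf q x n = 0) (hL' : ∀ x, x ∈ L' ↔ hf q x n' = 0)
    (f : (Fin 3 → F) ≃ₗ[F] (Fin 3 → F)) (hfm : ∀ x y, hf q (f x) (f y) = hf q x y)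
    (hn : f n = n') : pmap f '' cw q L = cw q L' := by
  subst hn
  ext pt
  constructor
  · rintro ⟨p, hp, rfl⟩
    induction p using Projectivization.ind with
    | h x hx =>
      rw [mk_mem_cw] at hp
      rw [pmap_mk, mk_mem_cw, hfm, hL', hfm, ← hL]
      exact hp
  · intro hp
    induction pt using Projectivization.ind with
    | h x hx =>
      rw [mk_mem_cw] at hp
      have hy : f.symm x ≠ 0 := f.symm.map_ne_zero_iff.mpr hx
      refine ⟨mk F (f.symm x) hy, ?_, ?_⟩
      · rw [mk_mem_cw, hL, ← hfm, ← hfm _ n]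
        simpa [hL'] using hp
      · rw [pmap_mk]; simp

theorem flag_map (h : Good F q) {L L' : Submodule F (Fin 3 → F)} (hL : Nd q L) (hL' : Nd q L')
    {u w u' w' : Projectivization F (Fin 3 → F)}
    (hu : u ∈ cw q L) (hw : hf q w.rep w.rep = 0 ∧ w ∉ cw q L)
    (hu' : u' ∈ cw q L') (hw' : hf q w'.rep w'.rep = 0 ∧ w' ∉ cw q L') :
    ∃ f : (Fin 3 → F) ≃ₗ[F] (Fin 3 → F),
      (∀ x y, hf q (f x) (f y) = hf q x y) ∧ pmap f '' cw q L = cw q L' ∧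
      pmap f u = u' ∧ pmap f w = w' := by
  obtain ⟨n, l, a, b, ha, hb, fr, hnl, hn⟩ := exists_frame h hL hu.2 u.rep_nonzero hu.1
    (fun hc => hw.2 ⟨hw.1, hc⟩) hw.1
  obtain ⟨n', l', a', b', ha', hb', fr', hnl', hn'⟩ := exists_frame h hL' hu'.2 u'.rep_nonzero hu'.1
    (fun hc => hw'.2 ⟨hw'.1, hc⟩) hw'.1
  obtain ⟨f, hfm, f1, f2, f3⟩ := fr.map h fr'
  refine ⟨f, hfm, image_cw hn hn' f hfm f1, ?_, ?_⟩
  · conv_rhs => rw [← mk_rep u']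
    unfold pmap
    rw [mk_eq_mk_iff']
    refine ⟨a⁻¹ * a', ?_⟩
    rw [mul_smul, ← f2, map_smul, smul_smul, inv_mul_cancel₀ ha, one_smul]
  · conv_rhs => rw [← mk_rep w']
    unfold pmap
    rw [mk_eq_mk_iff']
    refine ⟨b⁻¹ * b', ?_⟩
    rw [mul_smul, ← hnl', ← f1, ← f3, ← map_add, hnl, map_smul, smul_smul, inv_mul_cancel₀ hb, one_smul]

theorem card_cw (h : Good F q) [Finite F] {L : Submodule F (Fin 3 → F)} (hL : Nd q L) :
    (cw q L).ncard = q + 1 := by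
  obtain ⟨u, huL, hu0, hu⟩ := exists_iso h hL
  obtain ⟨v, hvL, hv, huv, hs⟩ := exists_pair h hL huL hu0 hu
  have hvu := hf_symm1 h huv
  have ne : ∀ t : F, v + t • u ≠ 0 := by
    intro t h0
    have : hf q (v + t • u) u = 0 := by rw [h0, hf_zero_left]
    rw [hf_add_left, hf_smul_left, hu, hvu] at this
    simp at this
  have key : cw q L = insert (mk F u hu0) ((fun t : F => mk F (v + t • u) (ne t)) '' {t | t + t ^ q = 0}) := by
    ext pt
    induction pt using Projectivization.ind with
    | h x hx =>
    rw [mk_mem_cw]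
    constructor
    · rintro ⟨h1, h2⟩
      rw [hs] at h2
      obtain ⟨a, b, rfl⟩ := Submodule.mem_span_pair.mp h2
      by_cases hb : b = 0
      · left
        rw [mk_eq_mk_iff']
        exact ⟨a, by simp [hb]⟩
      · right
        have e : a • u + b • v = b • (v + (a / b) • u) := by
          rw [smul_add, smul_smul, mul_div_cancel₀ _ hb, add_comm]
        refine ⟨a / b, ?_, ?_⟩
        · rw [e, hf_smul_left, hf_smul_right] at h1
          simp only [hf_add_left, hf_add_right h, hf_smul_left, hf_smul_right, hu, hv, huv, hvu] at h1
          have h3 := (mul_eq_zero.mp ((mul_eq_zero.mp h1).resolve_left hb)).resolve_left (pow_ne_zero _ hb)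
          show a / b + (a / b) ^ q = 0
          linear_combination h3
        · symm
          show mk F _ _ = mk F _ _
          rw [mk_eq_mk_iff']
          exact ⟨b, e.symm⟩
    · rintro (h1 | ⟨t, ht, h1⟩)
      · rw [← mk_mem_cw (hx := hx), h1, mk_mem_cw]; exact ⟨hu, huL⟩
      · rw [← mk_mem_cw (hx := hx), ← h1, mk_mem_cw]
        refine ⟨?_, L.add_mem hvL (L.smul_mem _ huL)⟩
        have ht : t + t ^ q = 0 := ht
        simp only [hf_add_left, hf_add_right h, hf_smul_left, hf_smul_right, hu, hv, huv, hvu]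
        linear_combination ht
  rw [key, Set.ncard_insert_of_notMem _ (Set.toFinite _), Set.InjOn.ncard_image, h.ker]
  · intro s _ t _ hst
    have hst : mk F _ _ = mk F _ _ := hst
    rw [mk_eq_mk_iff'] at hst
    obtain ⟨a, ha⟩ := hst
    have h1 := congrArg (fun z => hf q z u) ha
    have h2 := congrArg (fun z => hf q z v) ha
    simp only [hf_add_left, hf_smul_left, hu, hv, huv, hvu] at h1 h2
    have ha1 : a = 1 := by simpa using h1
    simpa [ha1] using h2.symm
  · rintro ⟨t, _, ht⟩
    have ht : mk F _ _ = mk F _ _ := ht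
    rw [mk_eq_mk_iff'] at ht
    obtain ⟨a, ha⟩ := ht
    have h1 := congrArg (fun z => hf q z u) ha
    simp [hf_add_left, hf_smul_left, hu, hvu] at h1

theorem exists_point (h : Good F q) {L : Submodule F (Fin 3 → F)} (hL : Nd q L) :
    ∃ u, u ∈ cw q L := by
  obtain ⟨u, huL, hu0, hu⟩ := exists_iso h hL
  exact ⟨mk F u hu0, (mk_mem_cw L hu0).mpr ⟨hu, huL⟩⟩

theorem exists_off (h : Good F q) {L : Submodule F (Fin 3 → F)} (hL : Nd q L) :
    ∃ w : Projectivization F (Fin 3 → F), hf q w.rep w.rep = 0 ∧ w ∉ cw q L := by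
  obtain ⟨u, huL, hu0, hu⟩ := exists_iso h hL
  obtain ⟨v, hvL, hv, huv, hs⟩ := exists_pair h hL huL hu0 hu
  obtain ⟨n, hn, hnu, hnv, hLn⟩ := exists_normal h hu hv huv hL hs
  obtain ⟨s, hs⟩ := h.trace (-1) (by
    have := h.add 1 (-1)
    rw [add_neg_cancel, zero_pow h.pos, one_pow] at this
    exact eq_neg_of_add_eq_zero_right this.symm)
  have hm : hf q (n + v + s • u) n ≠ 0 := by
    simp only [hf_add_left, hf_smul_left, hn, hf_symm0 h hnu, hf_symm0 h hnv]
    simp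
  have h0 : n + v + s • u ≠ 0 := by
    intro h0; rw [h0, hf_zero_left] at hm; exact hm rfl
  refine ⟨mk F _ h0, ?_, ?_⟩
  · rw [iso_mk]
    simp only [hf_add_left, hf_add_right h, hf_smul_left, hf_smul_right, hn, hu, hv, hnu, hnv, huv,
      hf_symm0 h hnu, hf_symm0 h hnv, hf_symm1 h huv]
    linear_combination hs
  · rw [mk_mem_cw, hLn]; exact fun hc => hm hc.2

theorem join (h : Good F q) {p p' : Projectivization F (Fin 3 → F)}
    (hp : hf q p.rep p.rep = 0) (hp' : hf q p'.rep p'.rep = 0) (hne : p ≠ p') :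
    ∃ L, Nd q L ∧ p ∈ cw q L ∧ p' ∈ cw q L := by
  have hpp : hf q p.rep p'.rep ≠ 0 := by
    intro h0
    obtain ⟨c, hc⟩ := prop_of_orth h p.rep_nonzero hp hp' h0
    apply hne
    rw [← mk_rep p, ← mk_rep p', eq_comm, mk_eq_mk_iff']
    exact ⟨c, hc.symm⟩
  exact ⟨_, span_nd h hp hp' hpp, ⟨hp, Submodule.subset_span (by simp)⟩,
    ⟨hp', Submodule.subset_span (by simp)⟩⟩

theorem join_unique {p p' : Projectivization F (Fin 3 → F)} (hne : p ≠ p')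
    {L L' : Submodule F (Fin 3 → F)} (hL : Nd q L) (hL' : Nd q L')
    (h1 : p ∈ cw q L) (h2 : p' ∈ cw q L) (h3 : p ∈ cw q L') (h4 : p' ∈ cw q L') : L = L' := by
  have hi : LinearIndependent F ![p.rep, p'.rep] := by
    rw [LinearIndependent.pair_iff' p.rep_nonzero]
    intro a ha
    apply hne
    rw [← mk_rep p, ← mk_rep p', eq_comm, mk_eq_mk_iff']
    exact ⟨a, ha⟩
  rw [span_of_indep hL.1 h1.2 h2.2 hi, span_of_indep hL'.1 h3.2 h4.2 hi]

end Unital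


/-- Example `ex-u` and Lemma `lem-u`: the classical unital is a
strongly incidence-transitive code with minimum distance `q`. -/
theorem stmt19 {F : Type*} [Field F] [Fintype F] [DecidableEq F] (q : ℕ)
    (hqpp : ∃ (p m : ℕ), p.Prime ∧ 1 ≤ m ∧ q = p ^ m)
    (hcard : Fintype.card F = q ^ 2)
    -- the Hermitian form
    (herm : (Fin 3 → F) → (Fin 3 → F) → F)
    (hherm : ∀ x y, herm x y = x 0 * (y 2) ^ q + x 2 * (y 0) ^ q + x 1 * (y 1) ^ q)
    -- 𝒱: the set of isotropic projective points
    (Iso : Set (Projectivization F (Fin 3 → F)))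
    (hIso : Iso = {pt | herm pt.rep pt.rep = 0})
    -- Γ: the classical unital, whose codewords are the sets of isotropic points of
    -- nondegenerate 2-dimensional subspaces
    (Γ : Set (Set (Projectivization F (Fin 3 → F))))
    (hΓ : Γ = {γ | ∃ L : Submodule F (Fin 3 → F), Module.finrank F L = 2 ∧
        (∀ u ∈ L, u ≠ 0 → ∃ w ∈ L, herm u w ≠ 0) ∧
        γ = {pt | herm pt.rep pt.rep = 0 ∧ pt.rep ∈ L}}) :
    -- every nondegenerate 2-dimensional subspace contains exactly q+1 points of 𝒱
    (∀ L : Submodule F (Fin 3 → F), Module.finrank F L = 2 →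
        (∀ u ∈ L, u ≠ 0 → ∃ w ∈ L, herm u w ≠ 0) →
        {pt : Projectivization F (Fin 3 → F) |
          herm pt.rep pt.rep = 0 ∧ pt.rep ∈ L}.ncard = q + 1) ∧
    -- Γ is strongly incidence-transitive under the unitary group GU(3,q)
    ((∀ γ ∈ Γ, ∀ γ' ∈ Γ, ∃ f : (Fin 3 → F) ≃ₗ[F] (Fin 3 → F),
        (∀ x y, herm (f x) (f y) = herm x y) ∧ pmap f '' γ = γ') ∧
     (∀ γ ∈ Γ, ∀ u ∈ γ, ∀ w ∈ Iso \ γ, ∀ u' ∈ γ, ∀ w' ∈ Iso \ γ,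
        ∃ f : (Fin 3 → F) ≃ₗ[F] (Fin 3 → F),
          (∀ x y, herm (f x) (f y) = herm x y) ∧
          pmap f '' γ = γ ∧ pmap f u = u' ∧ pmap f w = w')) ∧
    -- any two distinct points of 𝒱 lie in exactly one codeword
    (∀ pt ∈ Iso, ∀ pt' ∈ Iso, pt ≠ pt' → ∃! γ, γ ∈ Γ ∧ pt ∈ γ ∧ pt' ∈ γ) ∧
    -- so distinct codewords meet in at most one point
    (∀ γ ∈ Γ, ∀ γ' ∈ Γ, γ ≠ γ' → (γ ∩ γ' : Set _).Subsingleton) ∧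
    -- and the minimum distance of Γ is q
    sInf {d : ℕ | ∃ α ∈ Γ, ∃ β ∈ Γ, α ≠ β ∧ d = α.ncard - (α ∩ β).ncard} = q := by
  have h := Unital.good (F := F) q hqpp hcard
  obtain rfl : herm = Unital.hf q := by
    funext x y; rw [hherm]; rfl
  have hΓ' : ∀ γ, γ ∈ Γ ↔ ∃ L, Unital.Nd q L ∧ γ = Unital.cw q L := by
    intro γ
    rw [hΓ]
    constructor
    · rintro ⟨L, h1, h2, h3⟩; exact ⟨L, ⟨h1, h2⟩, h3⟩
    · rintro ⟨L, ⟨h1, h2⟩, h3⟩; exact ⟨L, h1, h2, h3⟩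
  have hI : ∀ p, p ∈ Iso ↔ Unital.hf q p.rep p.rep = 0 := by
    intro p; rw [hIso]; rfl
  have hsub : ∀ γ ∈ Γ, ∀ γ' ∈ Γ, γ ≠ γ' → (γ ∩ γ' : Set _).Subsingleton := by
    intro γ hγ γ' hγ' hne p hp p' hp'
    obtain ⟨L, hL, rfl⟩ := (hΓ' γ).mp hγ
    obtain ⟨L', hL', rfl⟩ := (hΓ' γ').mp hγ'
    by_contra hpp
    exact hne (by rw [Unital.join_unique hpp hL hL' hp.1 hp'.1 hp.2 hp'.2])
  refine ⟨fun L h1 h2 => Unital.card_cw h ⟨h1, h2⟩, ⟨?_, ?_⟩, ?_, hsub, ?_⟩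
  · intro γ hγ γ' hγ'
    obtain ⟨L, hL, rfl⟩ := (hΓ' γ).mp hγ
    obtain ⟨L', hL', rfl⟩ := (hΓ' γ').mp hγ'
    obtain ⟨u, hu⟩ := Unital.exists_point h hL
    obtain ⟨w, hw⟩ := Unital.exists_off h hL
    obtain ⟨u', hu'⟩ := Unital.exists_point h hL'
    obtain ⟨w', hw'⟩ := Unital.exists_off h hL'
    obtain ⟨f, h1, h2, -⟩ := Unital.flag_map h hL hL' hu hw hu' hw'
    exact ⟨f, h1, h2⟩
  · intro γ hγ u hu w hw u' hu' w' hw'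
    obtain ⟨L, hL, rfl⟩ := (hΓ' γ).mp hγ
    exact Unital.flag_map h hL hL hu ⟨(hI w).mp hw.1, hw.2⟩ hu' ⟨(hI w').mp hw'.1, hw'.2⟩
  · intro p hp p' hp' hne
    obtain ⟨L, hL, h1, h2⟩ := Unital.join h ((hI p).mp hp) ((hI p').mp hp') hne
    refine ⟨_, ⟨(hΓ' _).mpr ⟨L, hL, rfl⟩, h1, h2⟩, ?_⟩
    rintro γ ⟨hγ, h3, h4⟩
    obtain ⟨L', hL', rfl⟩ := (hΓ' γ).mp hγ
    rw [Unital.join_unique hne hL hL' h1 h2 h3 h4]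
  · have hc : ∀ γ ∈ Γ, γ.ncard = q + 1 := by
      intro γ hγ
      obtain ⟨L, hL, rfl⟩ := (hΓ' γ).mp hγ
      exact Unital.card_cw h hL
    apply IsLeast.csInf_eq
    constructor
    · have hL : Unital.Nd q (Submodule.span F {(![1, 0, 0] : Fin 3 → F), ![0, 0, 1]}) :=
        Unital.span_nd h (by simp [Unital.hf, h.pos]) (by simp [Unital.hf, h.pos])
          (by simp [Unital.hf])
      obtain ⟨u, hu⟩ := Unital.exists_point h hL
      obtain ⟨w, hw⟩ := Unital.exists_off h hL
      have hne : u ≠ w := by rintro rfl; exact hw.2 hu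
      obtain ⟨L', hL', h1, h2⟩ := Unital.join h hu.1 hw.1 hne
      have hγ := (hΓ' _).mpr ⟨_, hL, rfl⟩
      have hγ' := (hΓ' _).mpr ⟨_, hL', rfl⟩
      have hdif : Unital.cw q (Submodule.span F {(![1, 0, 0] : Fin 3 → F), ![0, 0, 1]})
          ≠ Unital.cw q L' := by
        intro he; apply hw.2; rw [he]; exact h2
      refine ⟨_, hγ, _, hγ', hdif, ?_⟩
      have hs := (hsub _ hγ _ hγ' hdif).eq_singleton_of_mem ⟨hu, h1⟩
      rw [hs, hc _ hγ, Set.ncard_singleton]; rfl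
    · rintro d ⟨α, hα, β, hβ, hne, rfl⟩
      have h1 := Set.ncard_le_one_iff_subsingleton.mpr (hsub α hα β hβ hne)
      rw [hc α hα]
      omega
end
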